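/- arXiv:0909.3002 — 8 statements merged into one kernel-verified Lean document; each statement's English description precedes it below -/
import Mathlib

section
/- For all positive real numbers α and β, the double series Σ_{m,n≥0} (α,m)(β,n)/(α+β+1, m+n) converges, and (Γ(α)Γ(β)/Γ(α+β+1))·Σ_{m,n≥0} (α,m)(β,n)/(α+β+1, m+n) equals the (absolutely convergent) double integral ∬_Δ u^{α−1}(1−u)^{−1} v^{β−1}(1−v)^{−1} du dv, where Δ = {(u,v) ∈ ℝ² : u ≥ 0, v ≥ 0, u+v ≤ 1}. -/
open MeasureTheory

/-- Pochhammer symbol `(α, n) = α(α+1)⋯(α+n-1)`. -/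
noncomputable def poch (α : ℝ) (n : ℕ) : ℝ := ∏ i ∈ Finset.range n, (α + i)

/-- `F̃(α,β) = (Γ(α)Γ(β)/Γ(α+β+1)) · Σ_{m,n≥0} (α,m)(β,n)/(α+β+1, m+n)`. -/
noncomputable def Ftilde (α β : ℝ) : ℝ :=
  (Real.Gamma α * Real.Gamma β / Real.Gamma (α + β + 1)) *
    ∑' p : ℕ × ℕ, poch α p.1 * poch β p.2 / poch (α + β + 1) (p.1 + p.2)

theorem Gamma_add_natCast_eq_poch_mul {α : ℝ} (hα : 0 < α) (n : ℕ) :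
    Real.Gamma (α + n) = poch α n * Real.Gamma α := by
  induction n with
  | zero => simp [poch]
  | succ n ih =>
    have h : poch α (n + 1) = poch α n * (α + n) := Finset.prod_range_succ _ _
    rw [Nat.cast_add_one, ← add_assoc, Real.Gamma_add_one (by positivity), ih, h]
    ring

theorem ofReal_rpow_mul_one_sub_rpow {a b x : ℝ} (hx : x ∈ Set.Ioo (0 : ℝ) 1) :
    ((x ^ (a - 1) * (1 - x) ^ (b - 1) : ℝ) : ℂ) =
      (x : ℂ) ^ ((a : ℂ) - 1) * (1 - (x : ℂ)) ^ ((b : ℂ) - 1) := by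
  rw [Complex.ofReal_mul, Complex.ofReal_cpow hx.1.le, Complex.ofReal_cpow (by linarith [hx.2])]
  push_cast
  rfl

theorem integrableOn_rpow_mul_one_sub_rpow {a b : ℝ} (ha : 0 < a) (hb : 0 < b) :
    IntegrableOn (fun x : ℝ => x ^ (a - 1) * (1 - x) ^ (b - 1)) (Set.Ioo 0 1) := by
  have h := Complex.betaIntegral_convergent (u := a) (v := b) (by simpa) (by simpa)
  rw [intervalIntegrable_iff_integrableOn_Ioo_of_le zero_le_one] at h
  refine IntegrableOn.congr_fun (f := fun x : ℝ =>
    ((x : ℂ) ^ ((a : ℂ) - 1) * (1 - (x : ℂ)) ^ ((b : ℂ) - 1)).re)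
    (Integrable.re h) (fun x hx => ?_) measurableSet_Ioo
  simp only [← ofReal_rpow_mul_one_sub_rpow hx, Complex.ofReal_re]

theorem setIntegral_rpow_mul_one_sub_rpow {a b : ℝ} (ha : 0 < a) (hb : 0 < b) :
    ∫ x in Set.Ioo (0 : ℝ) 1, x ^ (a - 1) * (1 - x) ^ (b - 1) =
      Real.Gamma a * Real.Gamma b / Real.Gamma (a + b) := by
  have h := Complex.betaIntegral_eq_Gamma_mul_div a b (by simpa) (by simpa)
  rw [Complex.betaIntegral, intervalIntegral.integral_of_le zero_le_one,
    integral_Ioc_eq_integral_Ioo, ← setIntegral_congr_fun measurableSet_Ioo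
      (fun x hx => ofReal_rpow_mul_one_sub_rpow hx), integral_complex_ofReal, ← Complex.ofReal_add,
    Complex.Gamma_ofReal, Complex.Gamma_ofReal, Complex.Gamma_ofReal] at h
  exact_mod_cast h

/-- The standard triangle without its two legs. -/
def openLegTriangle : Set (ℝ × ℝ) := {p | 0 < p.1 ∧ 0 < p.2 ∧ p.1 + p.2 ≤ 1}

theorem measurableSet_openLegTriangle : MeasurableSet openLegTriangle :=
  (measurableSet_lt measurable_const measurable_fst).inter
    ((measurableSet_lt measurable_const measurable_snd).inter
      (measurableSet_le (measurable_fst.add measurable_snd) measurable_const))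

theorem openLegTriangle_subset :
    openLegTriangle ⊆ Set.Ioo (0 : ℝ) 1 ×ˢ Set.Ioo (0 : ℝ) 1 := by
  rintro p ⟨h1, h2, h3⟩
  exact ⟨⟨h1, by linarith⟩, ⟨h2, by linarith⟩⟩

theorem closedTriangle_ae_eq_openLegTriangle :
    ({p : ℝ × ℝ | 0 ≤ p.1 ∧ 0 ≤ p.2 ∧ p.1 + p.2 ≤ 1} : Set (ℝ × ℝ)) =ᵐ[volume]
      openLegTriangle := by
  have h : ∀ᵐ x : ℝ, x ≠ 0 := Measure.ae_ne volume 0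
  have h1 : ∀ᵐ p : ℝ × ℝ, p.1 ≠ 0 :=
    (Measure.quasiMeasurePreserving_fst (μ := (volume : Measure ℝ)) (ν := (volume : Measure ℝ))).ae h
  have h2 : ∀ᵐ p : ℝ × ℝ, p.2 ≠ 0 :=
    (Measure.quasiMeasurePreserving_snd (μ := (volume : Measure ℝ)) (ν := (volume : Measure ℝ))).ae h
  filter_upwards [h1, h2] with p hp1 hp2
  refine propext ⟨fun h => ⟨h.1.lt_of_ne' hp1, h.2.1.lt_of_ne' hp2, h.2.2⟩,
    fun h => ⟨h.1.le, h.2.1.le, h.2.2⟩⟩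

theorem integrableOn_square_mul {f g : ℝ → ℝ} (hf : IntegrableOn f (Set.Ioo 0 1))
    (hg : IntegrableOn g (Set.Ioo 0 1)) :
    IntegrableOn (fun p : ℝ × ℝ => f p.1 * g p.2) openLegTriangle := by
  refine IntegrableOn.mono_set (t := Set.Ioo (0 : ℝ) 1 ×ˢ Set.Ioo (0 : ℝ) 1) ?_
    openLegTriangle_subset
  rw [IntegrableOn, Measure.volume_eq_prod, ← Measure.prod_restrict]
  exact Integrable.mul_prod hf hg

theorem integrableOn_rpow_sub_one {a : ℝ} (ha : 0 < a) :
    IntegrableOn (fun x : ℝ => x ^ (a - 1)) (Set.Ioo 0 1) := by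
  simpa using integrableOn_rpow_mul_one_sub_rpow ha one_pos

theorem setIntegral_openLegTriangle_rpow {a b : ℝ} (ha : 0 < a) (hb : 0 < b) :
    ∫ p in openLegTriangle, p.1 ^ (a - 1) * p.2 ^ (b - 1) =
      Real.Gamma a * Real.Gamma b / Real.Gamma (a + b + 1) := by
  have hint := integrableOn_square_mul (integrableOn_rpow_sub_one ha) (integrableOn_rpow_sub_one hb)
  rw [← integrable_indicator_iff measurableSet_openLegTriangle, Measure.volume_eq_prod] at hint
  rw [← integral_indicator measurableSet_openLegTriangle, Measure.volume_eq_prod,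
    integral_prod _ hint]
  have key : ∀ x : ℝ, ∫ y : ℝ, openLegTriangle.indicator
        (fun p : ℝ × ℝ => p.1 ^ (a - 1) * p.2 ^ (b - 1)) (x, y) =
      (Set.Ioo (0 : ℝ) 1).indicator
        (fun x => b⁻¹ * (x ^ (a - 1) * (1 - x) ^ (b + 1 - 1))) x := by
    intro x
    by_cases hx : x ∈ Set.Ioo (0 : ℝ) 1
    · have hslice : (fun y : ℝ => openLegTriangle.indicator
          (fun p : ℝ × ℝ => p.1 ^ (a - 1) * p.2 ^ (b - 1)) (x, y)) =
          (Set.Ioc (0 : ℝ) (1 - x)).indicator (fun y => x ^ (a - 1) * y ^ (b - 1)) := by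
        ext y
        have hmem : (x, y) ∈ openLegTriangle ↔ y ∈ Set.Ioc (0 : ℝ) (1 - x) :=
          ⟨fun h => ⟨h.2.1, by linarith [h.2.2]⟩, fun h => ⟨hx.1, h.1, by linarith [h.2]⟩⟩
        by_cases hy : y ∈ Set.Ioc (0 : ℝ) (1 - x)
        · rw [Set.indicator_of_mem (hmem.2 hy), Set.indicator_of_mem hy]
        · rw [Set.indicator_of_notMem (mt hmem.1 hy), Set.indicator_of_notMem hy]
      have hx' : 0 ≤ 1 - x := by linarith [hx.2]
      rw [hslice, integral_indicator measurableSet_Ioc, integral_const_mul,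
        ← intervalIntegral.integral_of_le hx', integral_rpow (Or.inl (by linarith)),
        Set.indicator_of_mem hx, sub_add_cancel, add_sub_cancel_right,
        Real.zero_rpow hb.ne', sub_zero]
      ring
    · have hnot : ∀ y : ℝ, (x, y) ∉ openLegTriangle := fun y h => hx (openLegTriangle_subset h).1
      simp [hnot, hx]
  simp_rw [key]
  rw [integral_indicator measurableSet_Ioo, integral_const_mul,
    setIntegral_rpow_mul_one_sub_rpow ha (by linarith), Real.Gamma_add_one hb.ne', ← add_assoc]
  field_simp

theorem triangle_integrand_le {α β u v : ℝ} (hα : 0 < α) (hβ : 0 < β)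
    (h : (u, v) ∈ openLegTriangle) :
    u ^ (α - 1) * (1 - u)⁻¹ * (v ^ (β - 1) * (1 - v)⁻¹) ≤
      u ^ (α / 2 - 1) * (1 - u) ^ (β / 2 - 1) * (v ^ (β / 2 - 1) * (1 - v) ^ (α / 2 - 1)) := by
  have aux : ∀ {c s t : ℝ}, 0 < c → 0 < s → s ≤ t →
      s ^ (c - 1) * t⁻¹ ≤ s ^ (c / 2 - 1) * t ^ (c / 2 - 1) := by
    intro c s t hc hs hst
    have ht := hs.trans_le hst
    have e1 : s ^ (c - 1) = s ^ (c / 2 - 1) * s ^ (c / 2) := by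
      rw [← Real.rpow_add hs]; ring_nf
    have e2 : t ^ (c / 2 - 1) = t ^ (c / 2) * t⁻¹ := by
      rw [Real.rpow_sub_one ht.ne', div_eq_mul_inv]
    rw [e1, e2, mul_assoc]
    gcongr
  obtain ⟨hu, hv, huv⟩ := h
  dsimp only at hu hv huv
  have h1 : 0 < 1 - u := by linarith
  have h2 : 0 < 1 - v := by linarith
  calc _ = (u ^ (α - 1) * (1 - v)⁻¹) * (v ^ (β - 1) * (1 - u)⁻¹) := by ring
    _ ≤ (u ^ (α / 2 - 1) * (1 - v) ^ (α / 2 - 1)) *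
        (v ^ (β / 2 - 1) * (1 - u) ^ (β / 2 - 1)) :=
      mul_le_mul (aux hα hu (by linarith)) (aux hβ hv (by linarith)) (by positivity)
        (by positivity)
    _ = _ := by ring

theorem integrableOn_openLegTriangle {α β : ℝ} (hα : 0 < α) (hβ : 0 < β) :
    IntegrableOn
      (fun p : ℝ × ℝ => p.1 ^ (α - 1) * (1 - p.1)⁻¹ * (p.2 ^ (β - 1) * (1 - p.2)⁻¹))
      openLegTriangle := by
  refine Integrable.mono' (integrableOn_square_mul
    (integrableOn_rpow_mul_one_sub_rpow (half_pos hα) (half_pos hβ))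
    (integrableOn_rpow_mul_one_sub_rpow (half_pos hβ) (half_pos hα))) ?_ ?_
  · exact Measurable.aestronglyMeasurable (by fun_prop)
  · filter_upwards [ae_restrict_mem measurableSet_openLegTriangle] with p hp
    have h1 : 0 < 1 - p.1 := by linarith [(openLegTriangle_subset hp).1.2]
    have h2 : 0 < 1 - p.2 := by linarith [(openLegTriangle_subset hp).2.2]
    have h3 := hp.1
    have h4 := hp.2.1
    rw [Real.norm_of_nonneg (by positivity)]
    exact triangle_integrand_le hα hβ hp

theorem hasSum_rpow_add_natCast_sub_one {α x : ℝ} (hx : x ∈ Set.Ioo (0 : ℝ) 1) :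
    HasSum (fun n : ℕ => x ^ (α + n - 1)) (x ^ (α - 1) * (1 - x)⁻¹) := by
  convert! (hasSum_geometric_of_lt_one hx.1.le hx.2).mul_left (x ^ (α - 1)) using 2 with n
  rw [← Real.rpow_natCast, ← Real.rpow_add hx.1]
  ring_nf

theorem hasSum_monomials_openLegTriangle {α β : ℝ} {p : ℝ × ℝ} (hp : p ∈ openLegTriangle) :
    HasSum (fun k : ℕ × ℕ => p.1 ^ (α + k.1 - 1) * p.2 ^ (β + k.2 - 1))
      (p.1 ^ (α - 1) * (1 - p.1)⁻¹ * (p.2 ^ (β - 1) * (1 - p.2)⁻¹)) := by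
  have h1 := hasSum_rpow_add_natCast_sub_one (α := α) (openLegTriangle_subset hp).1
  have h2 := hasSum_rpow_add_natCast_sub_one (α := β) (openLegTriangle_subset hp).2
  exact h1.mul h2 (h1.summable.mul_of_nonneg h2.summable
    (fun n => Real.rpow_nonneg hp.1.le _) (fun n => Real.rpow_nonneg hp.2.1.le _))

theorem hasSum_integral_openLegTriangle {α β : ℝ} (hα : 0 < α) (hβ : 0 < β) :
    HasSum (fun k : ℕ × ℕ => (Real.Gamma α * Real.Gamma β / Real.Gamma (α + β + 1)) *
        (poch α k.1 * poch β k.2 / poch (α + β + 1) (k.1 + k.2)))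
      (∫ p in openLegTriangle,
        p.1 ^ (α - 1) * (1 - p.1)⁻¹ * (p.2 ^ (β - 1) * (1 - p.2)⁻¹)) := by
  have hmem := ae_restrict_mem (μ := volume) measurableSet_openLegTriangle
  have hsum := hasSum_integral_of_dominated_convergence
    (μ := volume.restrict openLegTriangle)
    (F := fun (k : ℕ × ℕ) (p : ℝ × ℝ) => p.1 ^ (α + k.1 - 1) * p.2 ^ (β + k.2 - 1))
    (fun (k : ℕ × ℕ) (p : ℝ × ℝ) => p.1 ^ (α + k.1 - 1) * p.2 ^ (β + k.2 - 1))
    (fun k => Measurable.aestronglyMeasurable (by fun_prop))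
    (fun k => by
      filter_upwards [hmem] with p hp
      have h1 := hp.1
      have h2 := hp.2.1
      rw [Real.norm_of_nonneg (by positivity)])
    (hmem.mono fun p hp => (hasSum_monomials_openLegTriangle hp).summable)
    ((integrableOn_openLegTriangle hα hβ).congr
      (hmem.mono fun p hp => (hasSum_monomials_openLegTriangle hp).tsum_eq.symm))
    (hmem.mono fun p hp => hasSum_monomials_openLegTriangle hp)
  convert! hsum using 2 with k
  rw [setIntegral_openLegTriangle_rpow (by positivity) (by positivity),
    Gamma_add_natCast_eq_poch_mul hα, Gamma_add_natCast_eq_poch_mul hβ,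
    show α + k.1 + (β + k.2) + 1 = α + β + 1 + ((k.1 + k.2 : ℕ) : ℝ) by push_cast; ring,
    Gamma_add_natCast_eq_poch_mul (by positivity), div_mul_div_comm]
  ring

theorem stmt0 (α β : ℝ) (hα : 0 < α) (hβ : 0 < β) :
    Summable (fun p : ℕ × ℕ => poch α p.1 * poch β p.2 / poch (α + β + 1) (p.1 + p.2)) ∧
    IntegrableOn
      (fun p : ℝ × ℝ => p.1 ^ (α - 1) * (1 - p.1)⁻¹ * (p.2 ^ (β - 1) * (1 - p.2)⁻¹))
      {p : ℝ × ℝ | 0 ≤ p.1 ∧ 0 ≤ p.2 ∧ p.1 + p.2 ≤ 1} ∧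
    Ftilde α β =
      ∫ p in {p : ℝ × ℝ | 0 ≤ p.1 ∧ 0 ≤ p.2 ∧ p.1 + p.2 ≤ 1},
        p.1 ^ (α - 1) * (1 - p.1)⁻¹ * (p.2 ^ (β - 1) * (1 - p.2)⁻¹) := by
  have hsum := hasSum_integral_openLegTriangle hα hβ
  have hC : Real.Gamma α * Real.Gamma β / Real.Gamma (α + β + 1) ≠ 0 := by
    have h1 := Real.Gamma_pos_of_pos hα
    have h2 := Real.Gamma_pos_of_pos hβ
    have h3 := Real.Gamma_pos_of_pos (show 0 < α + β + 1 by positivity)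
    positivity
  refine ⟨(summable_mul_left_iff hC).1 hsum.summable,
    (integrableOn_openLegTriangle hα hβ).congr_set_ae closedTriangle_ae_eq_openLegTriangle, ?_⟩
  rw [Ftilde, ← tsum_mul_left, hsum.tsum_eq,
    setIntegral_congr_set closedTriangle_ae_eq_openLegTriangle]
end

section
/- Let α, α′, β, β′, γ be complex numbers such that γ is not a nonpositive integer, Re(γ−α−β) > 0 and Re(γ−α′−β′) > 0. Then for all complex numbers x, y with |x| ≤ 1 and |y| ≤ 1, the double series Σ_{m,n≥0} [(α,m)(α′,n)(β,m)(β′,n)/((γ,m+n)(1,m)(1,n))]·x^m y^n (Appell's hypergeometric series F₃(α,α′,β,β′,γ;x,y)) converges absolutely. -/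
/-- Pochhammer symbol (α, n) = α(α+1)⋯(α+n-1) for complex α. -/
noncomputable def cpoch (α : ℂ) (n : ℕ) : ℂ := ∏ i ∈ Finset.range n, (α + i)

open Filter Topology

theorem cpoch_one_eq_factorial (n : ℕ) : cpoch 1 n = (n.factorial : ℂ) := by
  induction n with
  | zero => simp [cpoch]
  | succ k ih =>
    rw [cpoch, Finset.prod_range_succ, ← cpoch, ih, Nat.factorial_succ]
    push_cast
    ring

theorem cpoch_ne_zero {s : ℂ} (hs : ∀ n : ℕ, s ≠ -(n : ℂ)) (n : ℕ) : cpoch s n ≠ 0 :=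
  Finset.prod_ne_zero_iff.2 fun i _ h => hs i (eq_neg_of_add_eq_zero_left h)

/-- The normalized size of the Pochhammer symbol, as predicted by Stirling's formula. -/
noncomputable def cpochRatio (s : ℂ) (n : ℕ) : ℝ :=
  ‖cpoch s n‖ / (n.factorial * ((n : ℝ) + 1) ^ (s.re - 1))

theorem cpochRatio_eq {s : ℂ} (hs : ∀ n : ℕ, s ≠ -(n : ℂ)) {n : ℕ} (hn : 0 < n) :
    cpochRatio s n = ‖Complex.GammaSeq s n‖⁻¹ * ‖(n : ℂ) / (s + n)‖ *
      ((n : ℝ) / (n + 1)) ^ (s.re - 1) := by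
  have hn' : (0 : ℝ) < n := by exact_mod_cast hn
  have hsn : ‖s + n‖ ≠ 0 := norm_ne_zero_iff.2 fun h => hs n (eq_neg_of_add_eq_zero_left h)
  have hc : ‖cpoch s n‖ ≠ 0 := norm_ne_zero_iff.2 (cpoch_ne_zero hs n)
  have hp : 0 < (n : ℝ) ^ s.re := Real.rpow_pos_of_pos hn' _
  have hq : 0 < ((n : ℝ) + 1) ^ (s.re - 1) := Real.rpow_pos_of_pos (by positivity) _
  rw [cpochRatio, Complex.GammaSeq, Finset.prod_range_succ, ← cpoch,
    Real.div_rpow hn'.le (by positivity), Real.rpow_sub_one hn'.ne' s.re]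
  simp only [norm_div, norm_mul, Complex.norm_natCast, Complex.norm_natCast_cpow_of_pos hn]
  field_simp

theorem tendsto_cpochRatio {s : ℂ} (hs : ∀ n : ℕ, s ≠ -(n : ℂ)) :
    Tendsto (cpochRatio s) atTop (𝓝 ‖Complex.Gamma s‖⁻¹) := by
  have h1 : Tendsto (fun n : ℕ => ‖Complex.GammaSeq s n‖⁻¹) atTop (𝓝 ‖Complex.Gamma s‖⁻¹) :=
    (Complex.GammaSeq_tendsto_Gamma s).norm.inv₀ (norm_ne_zero_iff.2 (Complex.Gamma_ne_zero hs))
  have h2 : Tendsto (fun n : ℕ => ‖(n : ℂ) / (s + n)‖) atTop (𝓝 1) := by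
    simpa [add_comm] using (tendsto_natCast_div_add_atTop (𝕜 := ℂ) s).norm
  have h3 : Tendsto (fun n : ℕ => ((n : ℝ) / (n + 1)) ^ (s.re - 1)) atTop (𝓝 1) := by
    simpa using (tendsto_natCast_div_add_atTop (𝕜 := ℝ) 1).rpow_const
      (p := s.re - 1) (Or.inl one_ne_zero)
  have h := (h1.mul h2).mul h3
  rw [mul_one, mul_one] at h
  refine h.congr' ?_
  filter_upwards [eventually_gt_atTop 0] with n hn
  exact (cpochRatio_eq hs hn).symm

theorem exists_norm_cpoch_le (s : ℂ) : ∃ C, 0 ≤ C ∧ ∀ n : ℕ,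
    ‖cpoch s n‖ ≤ C * (n.factorial * ((n : ℝ) + 1) ^ (s.re - 1)) := by
  have hb : BddAbove (Set.range (cpochRatio s)) := by
    by_cases hs : ∀ n : ℕ, s ≠ -(n : ℂ)
    · exact (tendsto_cpochRatio hs).bddAbove_range
    · push Not at hs
      obtain ⟨k, rfl⟩ := hs
      refine Tendsto.bddAbove_range (a := 0) (tendsto_const_nhds.congr' ?_)
      filter_upwards [eventually_gt_atTop k] with n hn
      have : cpoch (-(k : ℂ)) n = 0 :=
        Finset.prod_eq_zero (Finset.mem_range.2 hn) (neg_add_cancel _)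
      simp [cpochRatio, this]
  obtain ⟨C, hC⟩ := hb
  have hC' (n : ℕ) : cpochRatio s n ≤ C := hC ⟨n, rfl⟩
  refine ⟨C, le_trans (by unfold cpochRatio; positivity) (hC' 0), fun n => ?_⟩
  exact (div_le_iff₀ (by positivity)).1 (hC' n)

theorem exists_inv_norm_cpoch_le {s : ℂ} (hs : ∀ n : ℕ, s ≠ -(n : ℂ)) : ∃ C, 0 ≤ C ∧ ∀ n : ℕ,
    ‖cpoch s n‖⁻¹ ≤ C * ((n.factorial : ℝ)⁻¹ * ((n : ℝ) + 1) ^ (1 - s.re)) := by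
  obtain ⟨C, hC⟩ := ((tendsto_cpochRatio hs).inv₀ (inv_ne_zero
    (norm_ne_zero_iff.2 (Complex.Gamma_ne_zero hs)))).bddAbove_range
  have hC' (n : ℕ) : (cpochRatio s n)⁻¹ ≤ C := hC ⟨n, rfl⟩
  refine ⟨C, le_trans (by unfold cpochRatio; positivity) (hC' 0), fun n => ?_⟩
  have h := hC' n
  rw [cpochRatio, inv_div, div_eq_mul_inv, mul_comm] at h
  rw [← neg_sub s.re 1, Real.rpow_neg (by positivity), ← mul_inv, ← div_eq_mul_inv]
  exact (le_div_iff₀ (by positivity)).2 h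

theorem two_pow_mul_factorial_mul_factorial_le {m n : ℕ} (h : n ≤ m) :
    2 ^ n * (m.factorial * n.factorial) ≤ (m + n).factorial := by
  induction n with
  | zero => simp
  | succ k ih =>
    have ih := ih (by omega)
    rw [← add_assoc, Nat.factorial_succ (m + k), Nat.factorial_succ k]
    calc 2 ^ (k + 1) * (m.factorial * ((k + 1) * k.factorial))
        = (2 * (k + 1)) * (2 ^ k * (m.factorial * k.factorial)) := by ring
      _ ≤ _ := Nat.mul_le_mul (by omega) ih

theorem factorial_mul_factorial_div_le {m n : ℕ} (h : n ≤ m) :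
    (m.factorial : ℝ) * n.factorial * ((m + n).factorial : ℝ)⁻¹ ≤ (1 / 2) ^ n := by
  rw [← div_eq_mul_inv, div_le_iff₀ (by positivity), one_div, inv_pow, inv_mul_eq_div,
    le_div_iff₀ (by positivity), mul_comm]
  exact_mod_cast two_pow_mul_factorial_mul_factorial_le h

theorem add_add_one_rpow_le {m n : ℕ} (h : n ≤ m) (t : ℝ) :
    ((m : ℝ) + n + 1) ^ t ≤ 2 ^ |t| * ((m : ℝ) + 1) ^ t := by
  have hnm : (n : ℝ) ≤ m := by exact_mod_cast h
  have hm : (0 : ℝ) < (m : ℝ) + 1 := by positivity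
  rw [← div_le_iff₀ (by positivity), ← Real.div_rpow (by positivity) hm.le]
  have h1 : 1 ≤ ((m : ℝ) + n + 1) / (m + 1) :=
    (one_le_div hm).2 (by linarith [n.cast_nonneg (α := ℝ)])
  have h2 : ((m : ℝ) + n + 1) / (m + 1) ≤ 2 := (div_le_iff₀ hm).2 (by linarith)
  exact (Real.rpow_le_rpow_of_exponent_le h1 (le_abs_self t)).trans
    (Real.rpow_le_rpow (by positivity) h2 (abs_nonneg t))

theorem factorial_rpow_le {m n : ℕ} (h : n ≤ m) (a b t : ℝ) :
    (m.factorial : ℝ) * n.factorial * ((m + n).factorial : ℝ)⁻¹ *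
      (((m : ℝ) + 1) ^ a * ((n : ℝ) + 1) ^ b * ((m : ℝ) + n + 1) ^ t) ≤
    2 ^ |t| * (((m : ℝ) + 1) ^ (a + t) * (((n : ℝ) + 1) ^ b * (1 / 2) ^ n)) := by
  calc _ ≤ (1 / 2 : ℝ) ^ n * (((m : ℝ) + 1) ^ a * ((n : ℝ) + 1) ^ b *
          (2 ^ |t| * ((m : ℝ) + 1) ^ t)) := by
        gcongr
        · exact factorial_mul_factorial_div_le h
        · exact add_add_one_rpow_le h t
    _ = _ := by rw [Real.rpow_add (by positivity)]; ring

theorem summable_add_one_rpow_mul_half_pow (t : ℝ) :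
    Summable fun n : ℕ => ((n : ℝ) + 1) ^ t * (1 / 2) ^ n := by
  have h := (summable_nat_add_iff 1).2
    (summable_pow_mul_geometric_of_norm_lt_one (R := ℝ) ⌈t⌉₊ (r := 1 / 2) (by norm_num))
  refine (h.mul_left 2).of_nonneg_of_le (fun n => by positivity) fun n => ?_
  have : ((n : ℝ) + 1) ^ t ≤ ((n : ℝ) + 1) ^ ⌈t⌉₊ := by
    rw [← Real.rpow_natCast]
    exact Real.rpow_le_rpow_of_exponent_le (by linarith [n.cast_nonneg (α := ℝ)]) (Nat.le_ceil t)
  calc _ ≤ ((n : ℝ) + 1) ^ ⌈t⌉₊ * (1 / 2) ^ n := by gcongr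
    _ = _ := by push_cast; ring

theorem summable_add_one_rpow {t : ℝ} (ht : t < -1) :
    Summable fun n : ℕ => ((n : ℝ) + 1) ^ t := by
  simpa using (summable_nat_add_iff 1).2 (Real.summable_nat_rpow.2 ht)

theorem summable_factorial_rpow {a b t : ℝ} (ha : a + t < -1) (hb : b + t < -1) :
    Summable fun p : ℕ × ℕ => (p.1.factorial : ℝ) * p.2.factorial *
      ((p.1 + p.2).factorial : ℝ)⁻¹ *
      (((p.1 : ℝ) + 1) ^ a * ((p.2 : ℝ) + 1) ^ b * ((p.1 : ℝ) + p.2 + 1) ^ t) := by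
  have h1 := (summable_add_one_rpow ha).mul_of_nonneg (summable_add_one_rpow_mul_half_pow b)
    (fun _ => by positivity) (fun _ => by positivity)
  have h2 := (summable_add_one_rpow_mul_half_pow a).mul_of_nonneg (summable_add_one_rpow hb)
    (fun _ => by positivity) (fun _ => by positivity)
  refine ((h1.mul_left (2 ^ |t|)).add (h2.mul_left (2 ^ |t|))).of_nonneg_of_le
    (fun _ => by positivity) ?_
  rintro ⟨m, n⟩
  rcases le_total n m with h | h
  · exact (factorial_rpow_le h a b t).trans (le_add_of_nonneg_right (by positivity))
  · refine le_trans (le_of_eq_of_le ?_ (factorial_rpow_le h b a t))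
      (le_trans (le_of_eq ?_) (le_add_of_nonneg_left (by positivity)))
    · rw [add_comm m n, add_comm (m : ℝ) n]; ring
    · ring

theorem stmt1 (α α' β β' γ : ℂ) (hγ : ∀ n : ℕ, γ ≠ -(n : ℂ))
    (h1 : 0 < (γ - α - β).re) (h2 : 0 < (γ - α' - β').re)
    (x y : ℂ) (hx : ‖x‖ ≤ 1) (hy : ‖y‖ ≤ 1) :
    Summable (fun p : ℕ × ℕ =>
      ‖cpoch α p.1 * cpoch α' p.2 * cpoch β p.1 * cpoch β' p.2 /
          (cpoch γ (p.1 + p.2) * cpoch 1 p.1 * cpoch 1 p.2) * x ^ p.1 * y ^ p.2‖) := by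
  obtain ⟨A, hA, hα⟩ := exists_norm_cpoch_le α
  obtain ⟨A', hA', hα'⟩ := exists_norm_cpoch_le α'
  obtain ⟨B, hB, hβ⟩ := exists_norm_cpoch_le β
  obtain ⟨B', hB', hβ'⟩ := exists_norm_cpoch_le β'
  obtain ⟨C, hC, hγC⟩ := exists_inv_norm_cpoch_le hγ
  simp only [Complex.sub_re] at h1 h2
  have hsum := summable_factorial_rpow (a := (α.re - 1) + (β.re - 1))
    (b := (α'.re - 1) + (β'.re - 1)) (t := 1 - γ.re) (by linarith) (by linarith)
  refine (hsum.mul_left (A * A' * B * B' * C)).of_nonneg_of_le (fun _ => norm_nonneg _) ?_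
  rintro ⟨m, n⟩
  have hγmn := hγC (m + n)
  push_cast at hγmn
  simp only [norm_mul, norm_div, norm_pow, cpoch_one_eq_factorial, Complex.norm_natCast]
  calc _ = ‖cpoch α m‖ * ‖cpoch α' n‖ * ‖cpoch β m‖ * ‖cpoch β' n‖ * ‖cpoch γ (m + n)‖⁻¹ *
          ((m.factorial : ℝ)⁻¹ * (n.factorial : ℝ)⁻¹) * ‖x‖ ^ m * ‖y‖ ^ n := by
        rw [div_eq_mul_inv, mul_inv, mul_inv]; ring
    _ ≤ (A * (m.factorial * ((m : ℝ) + 1) ^ (α.re - 1))) *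
          (A' * (n.factorial * ((n : ℝ) + 1) ^ (α'.re - 1))) *
          (B * (m.factorial * ((m : ℝ) + 1) ^ (β.re - 1))) *
          (B' * (n.factorial * ((n : ℝ) + 1) ^ (β'.re - 1))) *
          (C * (((m + n).factorial : ℝ)⁻¹ * ((m : ℝ) + n + 1) ^ (1 - γ.re))) *
          ((m.factorial : ℝ)⁻¹ * (n.factorial : ℝ)⁻¹) * 1 * 1 := by
        gcongr
        · exact hα m
        · exact hα' n
        · exact hβ m
        · exact hβ' n
        · exact pow_le_one₀ (norm_nonneg x) hx
        · exact pow_le_one₀ (norm_nonneg y) hy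
    _ = _ := by
        rw [Real.rpow_add (by positivity), Real.rpow_add (by positivity)]
        field_simp
end

section
/- The function F̃ is strictly decreasing in each variable: for all positive real numbers α, α′, β, β′, if α < α′ then F̃(α′,β) < F̃(α,β), and if β < β′ then F̃(α,β′) < F̃(α,β). -/
open Filter Topology

theorem poch_mul_Gamma {a : ℝ} (ha : 0 < a) (n : ℕ) :
    poch a n * Real.Gamma a = Real.Gamma (a + n) := by
  induction n with
  | zero => simp [poch]
  | succ n ih =>
    have h : poch a (n + 1) = poch a n * (a + n) := Finset.prod_range_succ _ _
    rw [h, Nat.cast_succ, ← add_assoc, Real.Gamma_add_one (by positivity), ← ih]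
    ring

/-- The ratio `Γ(x) / Γ(x + c)`. -/
noncomputable def gammaRatio (c x : ℝ) : ℝ := Real.Gamma x / Real.Gamma (x + c)

theorem gammaRatio_pos {c x : ℝ} (hc : 0 < c) (hx : 0 < x) : 0 < gammaRatio c x :=
  div_pos (Real.Gamma_pos_of_pos hx) (Real.Gamma_pos_of_pos (by positivity))

theorem gammaRatio_sub_succ {c x : ℝ} (hc : 0 < c) (hx : 0 < x) :
    gammaRatio c x - gammaRatio c (x + 1) = c / (x + c) * gammaRatio c x := by
  have hxc : 0 < x + c := by positivity
  have h := (Real.Gamma_pos_of_pos hxc).ne'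
  unfold gammaRatio
  rw [show x + 1 + c = x + c + 1 by ring, Real.Gamma_add_one hxc.ne', Real.Gamma_add_one hx.ne']
  field_simp
  ring

/-- Log-convexity of `Γ` makes `Γ(x) / Γ(x + c)` antitone in `x`. -/
theorem gammaRatio_le {c x y : ℝ} (hc : 0 < c) (hx : 0 < x) (hxy : x ≤ y) :
    gammaRatio c y ≤ gammaRatio c x := by
  have hy : 0 < y := hx.trans_le hxy
  have hd : 0 < y - x + c := by linarith
  have hyc : 0 < y + c := by positivity
  have hxc : 0 < x + c := by positivity
  have hs : 0 ≤ (y - x) / (y - x + c) := div_nonneg (by linarith) hd.le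
  have ht : 0 ≤ c / (y - x + c) := by positivity
  have hst : (y - x) / (y - x + c) + c / (y - x + c) = 1 := by field_simp
  have h₁ := Real.convexOn_log_Gamma.2 (Set.mem_Ioi.2 hx) (Set.mem_Ioi.2 hyc) hs ht hst
  have h₂ := Real.convexOn_log_Gamma.2 (Set.mem_Ioi.2 hx) (Set.mem_Ioi.2 hyc) ht hs
    (by rw [add_comm, hst])
  have e₁ : (y - x) / (y - x + c) * x + c / (y - x + c) * (y + c) = x + c := by
    field_simp; ring
  have e₂ : c / (y - x + c) * x + (y - x) / (y - x + c) * (y + c) = y := by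
    field_simp; ring
  simp only [smul_eq_mul, Function.comp_apply, e₁, e₂] at h₁ h₂
  have hlog : Real.log (Real.Gamma y) + Real.log (Real.Gamma (x + c)) ≤
      Real.log (Real.Gamma x) + Real.log (Real.Gamma (y + c)) := by
    calc _ ≤ ((y - x) / (y - x + c) + c / (y - x + c)) *
          (Real.log (Real.Gamma x) + Real.log (Real.Gamma (y + c))) := by linarith
      _ = _ := by rw [hst, one_mul]
  have px := Real.Gamma_pos_of_pos hx
  have py := Real.Gamma_pos_of_pos hy
  have pxc := Real.Gamma_pos_of_pos hxc
  have pyc := Real.Gamma_pos_of_pos hyc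
  rw [← Real.log_mul py.ne' pxc.ne', ← Real.log_mul px.ne' pyc.ne',
    Real.log_le_log_iff (by positivity) (by positivity)] at hlog
  exact (div_le_div_iff₀ pyc pxc).2 hlog

theorem sum_range_gammaRatio {c x : ℝ} (hc : 0 < c) (hx : 0 < x) (N : ℕ) :
    ∑ n ∈ Finset.range N, c / (x + n + c) * gammaRatio c (x + n) =
      gammaRatio c x - gammaRatio c (x + N) := by
  have h (n : ℕ) : c / (x + n + c) * gammaRatio c (x + n) =
      gammaRatio c (x + n) - gammaRatio c (x + (n + 1 : ℕ)) := by
    rw [Nat.cast_succ, ← add_assoc, gammaRatio_sub_succ hc (by positivity)]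
  simp only [h, Finset.sum_range_sub' (fun n : ℕ => gammaRatio c (x + n)), Nat.cast_zero, add_zero]

theorem summable_gammaRatio {c x : ℝ} (hc : 0 < c) (hx : 0 < x) :
    Summable fun n : ℕ => c / (x + n + c) * gammaRatio c (x + n) := by
  refine summable_of_sum_range_le (c := gammaRatio c x) (fun n => ?_) fun N => ?_
  · have := gammaRatio_pos hc (show 0 < x + n by positivity)
    positivity
  · rw [sum_range_gammaRatio hc hx]
    linarith [gammaRatio_pos hc (show 0 < x + N by positivity)]

theorem not_summable_div_add {c y : ℝ} (hc : 0 < c) (hy : 0 < y) :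
    ¬ Summable fun n : ℕ => c / (n + y) := by
  intro h
  obtain ⟨k, hk⟩ := exists_nat_ge y
  have h' : Summable fun n : ℕ => 1 / ((n + k : ℕ) : ℝ) := by
    refine (h.mul_left c⁻¹).of_nonneg_of_le (fun n => by positivity) fun n => ?_
    have : c⁻¹ * (c / (n + y)) = 1 / (n + y) := by field_simp
    rw [this]
    push_cast
    gcongr
  exact Real.not_summable_one_div_natCast
    ((summable_nat_add_iff (f := fun n : ℕ => 1 / (n : ℝ)) k).1 h')

theorem tendsto_gammaRatio {c x : ℝ} (hc : 0 < c) (hx : 0 < x) :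
    Tendsto (fun n : ℕ => gammaRatio c (x + n)) atTop (𝓝 0) := by
  have hanti : Antitone fun n : ℕ => gammaRatio c (x + n) := fun m n hmn =>
    gammaRatio_le hc (by positivity) (by gcongr)
  have hpos (n : ℕ) : 0 < gammaRatio c (x + n) := gammaRatio_pos hc (by positivity)
  have hbdd : BddBelow (Set.range fun n : ℕ => gammaRatio c (x + n)) :=
    ⟨0, by rintro _ ⟨n, rfl⟩; exact (hpos n).le⟩
  have hlim := tendsto_atTop_ciInf hanti hbdd
  set L := ⨅ n : ℕ, gammaRatio c (x + n)
  have hL0 : 0 ≤ L := le_ciInf fun n => (hpos n).le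
  rcases hL0.eq_or_lt with h0 | hLpos
  · rwa [← h0] at hlim
  · refine absurd ?_ (not_summable_div_add (mul_pos hc hLpos) (add_pos hx hc))
    refine (summable_gammaRatio hc hx).of_nonneg_of_le (fun n => by positivity) fun n => ?_
    have hle : L ≤ gammaRatio c (x + n) := ciInf_le hbdd n
    calc c * L / (n + (x + c)) = c / (x + n + c) * L := by
          rw [show (n : ℝ) + (x + c) = x + n + c by ring]; ring
      _ ≤ _ := by gcongr

theorem hasSum_gammaRatio {c x : ℝ} (hc : 0 < c) (hx : 0 < x) :
    HasSum (fun n : ℕ => c / (x + n + c) * gammaRatio c (x + n)) (gammaRatio c x) := by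
  refine (summable_gammaRatio hc hx).hasSum_iff_tendsto_nat.2 ?_
  simp only [sum_range_gammaRatio hc hx]
  simpa using (tendsto_gammaRatio hc hx).const_sub (gammaRatio c x)

theorem hasSum_Gamma_div_Gamma {c x : ℝ} (hc : 0 < c) (hx : 0 < x) :
    HasSum (fun n : ℕ => Real.Gamma (x + n) / Real.Gamma (x + n + c + 1))
      (gammaRatio c x / c) := by
  refine ((hasSum_gammaRatio hc hx).div_const c).congr_fun fun n => ?_
  have h : 0 < x + n + c := by positivity
  rw [Real.Gamma_add_one h.ne', gammaRatio]
  field_simp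

theorem summable_gammaRatio_div {c x : ℝ} (hc : 0 < c) (hx : 0 < x) :
    Summable fun n : ℕ => gammaRatio c (x + n) / (x + n) := by
  refine ((summable_gammaRatio hc hx).mul_left ((x + c) / (x * c))).of_nonneg_of_le
    (fun n => ?_) fun n => ?_
  · have := gammaRatio_pos hc (show 0 < x + n by positivity)
    positivity
  · have hp := gammaRatio_pos hc (show 0 < x + n by positivity)
    have hle : 1 / (x + n) ≤ (x + c) / (x * c) * (c / (x + n + c)) := by
      have : (x + c) / (x * c) * (c / (x + n + c)) = (x + c) / (x * (x + n + c)) := by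
        field_simp
      rw [this, div_le_div_iff₀ (by positivity) (by positivity)]
      have : 0 ≤ (n : ℝ) * c := by positivity
      nlinarith
    calc gammaRatio c (x + n) / (x + n) = 1 / (x + n) * gammaRatio c (x + n) := by ring
      _ ≤ (x + c) / (x * c) * (c / (x + n + c)) * gammaRatio c (x + n) := by gcongr
      _ = _ := by ring

/-- Summing the double series over `n` first. -/
theorem Ftilde_eq_tsum {a b : ℝ} (ha : 0 < a) (hb : 0 < b) :
    Ftilde a b = Real.Gamma b * ∑' m : ℕ, gammaRatio b (a + m) / (a + m) := by
  have hterm (p : ℕ × ℕ) : Real.Gamma a * Real.Gamma b / Real.Gamma (a + b + 1) *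
      (poch a p.1 * poch b p.2 / poch (a + b + 1) (p.1 + p.2)) =
      Real.Gamma (a + p.1) *
        (Real.Gamma (b + p.2) / Real.Gamma (b + p.2 + (a + p.1) + 1)) := by
    have hc : 0 < a + b + 1 := by positivity
    rw [show b + p.2 + (a + p.1) + 1 = a + b + 1 + (p.1 + p.2 : ℕ) by push_cast; ring,
      ← poch_mul_Gamma ha, ← poch_mul_Gamma hb, ← poch_mul_Gamma hc, div_mul_div_comm,
      ← mul_div_assoc]
    congr 1 <;> ring
  have hinner (m : ℕ) : HasSum (fun n : ℕ => Real.Gamma (a + m) *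
      (Real.Gamma (b + n) / Real.Gamma (b + n + (a + m) + 1)))
      (Real.Gamma b * (gammaRatio b (a + m) / (a + m))) := by
    have h := (hasSum_Gamma_div_Gamma (c := a + m) (by positivity) hb).mul_left
      (Real.Gamma (a + m))
    have heq : Real.Gamma b * (gammaRatio b (a + m) / (a + m)) =
        Real.Gamma (a + m) * (gammaRatio (a + m) b / (a + m)) := by
      simp only [gammaRatio, add_comm b]
      ring
    rwa [heq]
  have hsum : Summable fun p : ℕ × ℕ => Real.Gamma (a + p.1) *
      (Real.Gamma (b + p.2) / Real.Gamma (b + p.2 + (a + p.1) + 1)) := by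
    refine (summable_prod_of_nonneg fun p => ?_).2 ⟨fun m => (hinner m).summable, ?_⟩
    · have h₁ := Real.Gamma_pos_of_pos (show 0 < a + p.1 by positivity)
      have h₂ := Real.Gamma_pos_of_pos (show 0 < b + p.2 by positivity)
      have h₃ := Real.Gamma_pos_of_pos (show 0 < b + p.2 + (a + p.1) + 1 by positivity)
      exact (mul_pos h₁ (div_pos h₂ h₃)).le
    · simp only [(hinner _).tsum_eq]
      exact (summable_gammaRatio_div hb ha).mul_left _
  rw [Ftilde, ← tsum_mul_left, tsum_congr hterm, hsum.tsum_prod, ← tsum_mul_left]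
  exact tsum_congr fun m => (hinner m).tsum_eq

theorem Ftilde_comm (a b : ℝ) : Ftilde a b = Ftilde b a := by
  rw [Ftilde, Ftilde, ← (Equiv.prodComm ℕ ℕ).tsum_eq, add_comm a b,
    mul_comm (Real.Gamma a)]
  congr 1
  refine tsum_congr fun p => ?_
  simp only [Equiv.prodComm_apply, Prod.fst_swap, Prod.snd_swap]
  rw [mul_comm (poch a _), add_comm p.2]

theorem Ftilde_lt_left {a a' b : ℝ} (ha : 0 < a) (hb : 0 < b) (h : a < a') :
    Ftilde a' b < Ftilde a b := by
  have ha' := ha.trans h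
  rw [Ftilde_eq_tsum ha hb, Ftilde_eq_tsum ha' hb]
  have hlt (m : ℕ) : gammaRatio b (a' + m) / (a' + m) < gammaRatio b (a + m) / (a + m) :=
    div_lt_div₀' (gammaRatio_le hb (by positivity) (by linarith)) (by linarith)
      (gammaRatio_pos hb (by positivity)) (by positivity)
  exact mul_lt_mul_of_pos_left ((summable_gammaRatio_div hb ha').tsum_lt_tsum
    (fun m => (hlt m).le) (hlt 0) (summable_gammaRatio_div hb ha)) (Real.Gamma_pos_of_pos hb)

theorem stmt2 (α α' β β' : ℝ) (hα : 0 < α) (hα' : 0 < α') (hβ : 0 < β) (hβ' : 0 < β') :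
    (α < α' → Ftilde α' β < Ftilde α β) ∧ (β < β' → Ftilde α β' < Ftilde α β) := by
  refine ⟨Ftilde_lt_left hα hβ, fun h => ?_⟩
  rw [Ftilde_comm α β', Ftilde_comm α β]
  exact Ftilde_lt_left hβ hα h
end

section
/- For real numbers α, β with 0 < α < 1 and 0 < β < 1, one has F̃(α,β) ≠ F̃(1−α,1−β) if and only if α+β ≠ 1. More precisely, F̃(α,β) > F̃(1−α,1−β) when α+β < 1, F̃(α,β) < F̃(1−α,1−β) when α+β > 1, and F̃(α,β) = F̃(1−α,1−β) when α+β = 1. -/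
theorem Gamma_add_eq_poch_mul {x : ℝ} (hx : 0 < x) (n : ℕ) :
    Real.Gamma (x + n) = poch x n * Real.Gamma x := by
  induction n with
  | zero => simp [poch]
  | succ n ih =>
    have h : x + n ≠ 0 := by positivity
    have hs : poch x (n + 1) = poch x n * (x + n) := Finset.prod_range_succ _ _
    rw [hs, Nat.cast_succ, ← add_assoc, Real.Gamma_add_one h, ih]
    ring

theorem Gamma_mul_Gamma_add_le {a b c : ℝ} (ha : 0 < a) (hab : a < b) (hc : 0 < c) :
    Real.Gamma (a + c) * Real.Gamma b ≤ Real.Gamma a * Real.Gamma (b + c) := by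
  have hd : 0 < b - a + c := by linarith
  have hconv := Real.convexOn_log_Gamma.2
  have ha' : a ∈ Set.Ioi (0 : ℝ) := ha
  have hbc : b + c ∈ Set.Ioi (0 : ℝ) := by simp only [Set.mem_Ioi]; linarith
  have hs : (b - a) / (b - a + c) + c / (b - a + c) = 1 := by field_simp
  have ht0 : 0 ≤ c / (b - a + c) := by positivity
  have hu0 : 0 ≤ (b - a) / (b - a + c) := div_nonneg (by linarith) hd.le
  have h1 := hconv ha' hbc hu0 ht0 hs
  have h2 := hconv ha' hbc ht0 hu0 ((add_comm _ _).trans hs)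
  simp only [smul_eq_mul, Function.comp_apply] at h1 h2
  rw [show (b - a) / (b - a + c) * a + c / (b - a + c) * (b + c) = a + c by
    field_simp; ring] at h1
  rw [show c / (b - a + c) * a + (b - a) / (b - a + c) * (b + c) = b by
    field_simp; ring] at h2
  have g1 := Real.Gamma_pos_of_pos ha
  have g2 := Real.Gamma_pos_of_pos (ha.trans hab)
  have g3 := Real.Gamma_pos_of_pos (add_pos ha hc)
  have g4 := Real.Gamma_pos_of_pos (add_pos (ha.trans hab) hc)
  rw [← Real.log_le_log_iff (by positivity) (by positivity), Real.log_mul g3.ne' g2.ne',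
    Real.log_mul g1.ne' g4.ne']
  have hu : (b - a) / (b - a + c) = 1 - c / (b - a + c) := by linarith
  rw [hu] at h1 h2
  linarith

theorem Gamma_mul_Gamma_add_lt {a b c : ℝ} (ha : 0 < a) (hab : a < b) (hc : 0 < c) :
    Real.Gamma (a + c) * Real.Gamma b < Real.Gamma a * Real.Gamma (b + c) := by
  have hb := ha.trans hab
  have h := Gamma_mul_Gamma_add_le (add_pos ha one_pos) (add_lt_add_left hab 1) hc
  rw [add_right_comm a, add_right_comm b, Real.Gamma_add_one ha.ne', Real.Gamma_add_one hb.ne',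
    Real.Gamma_add_one (add_pos ha hc).ne', Real.Gamma_add_one (add_pos hb hc).ne'] at h
  have hpos : 0 < Real.Gamma (a + c) * Real.Gamma b :=
    mul_pos (Real.Gamma_pos_of_pos (add_pos ha hc)) (Real.Gamma_pos_of_pos hb)
  have hk : a * (b + c) < (a + c) * b := by nlinarith
  have hk0 : 0 < a * (b + c) := by positivity
  refine lt_of_mul_lt_mul_left ?_ hk0.le
  calc a * (b + c) * (Real.Gamma (a + c) * Real.Gamma b)
      < (a + c) * b * (Real.Gamma (a + c) * Real.Gamma b) := mul_lt_mul_of_pos_right hk hpos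
    _ ≤ a * (b + c) * (Real.Gamma a * Real.Gamma (b + c)) := by linarith

theorem Gamma_div_Gamma_add_lt {a b c : ℝ} (ha : 0 < a) (hab : a < b) (hc : 0 < c) :
    Real.Gamma b / Real.Gamma (b + c) < Real.Gamma a / Real.Gamma (a + c) := by
  rw [div_lt_div_iff₀ (Real.Gamma_pos_of_pos (add_pos (ha.trans hab) hc))
    (Real.Gamma_pos_of_pos (add_pos ha hc))]
  linarith [Gamma_mul_Gamma_add_lt ha hab hc]

theorem sum_range_Gamma_div_le {x c : ℝ} (hx : 0 < x) (hc : 0 < c) (N : ℕ) :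
    ∑ n ∈ Finset.range N, Real.Gamma (x + n) / Real.Gamma (x + c + 1 + n) ≤
      Real.Gamma x / Real.Gamma (x + c) / c := by
  have key (n : ℕ) : Real.Gamma (x + n) / Real.Gamma (x + c + 1 + n) =
      Real.Gamma (x + n) / Real.Gamma (x + c + n) / c -
        Real.Gamma (x + (n + 1 : ℕ)) / Real.Gamma (x + c + (n + 1 : ℕ)) / c := by
    have h1 : 0 < x + n := by positivity
    have h2 : 0 < x + c + n := by positivity
    have g := (Real.Gamma_pos_of_pos h2).ne'
    rw [Nat.cast_succ, ← add_assoc, ← add_assoc, add_right_comm (x + c) 1,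
      Real.Gamma_add_one h1.ne', Real.Gamma_add_one h2.ne']
    field_simp
    ring
  rw [Finset.sum_congr rfl fun n _ => key n, Finset.sum_range_sub']
  have g1 := Real.Gamma_pos_of_pos (show 0 < x + N by positivity)
  have g2 := Real.Gamma_pos_of_pos (show 0 < x + c + N by positivity)
  have : 0 ≤ Real.Gamma (x + N) / Real.Gamma (x + c + N) / c := by positivity
  simpa using this

theorem Gamma_div_nonneg {x y : ℝ} (hx : 0 < x) (hy : 0 < y) (n : ℕ) :
    0 ≤ Real.Gamma (x + n) / Real.Gamma (y + n) :=
  div_nonneg (Real.Gamma_pos_of_pos (by positivity)).le (Real.Gamma_pos_of_pos (by positivity)).le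

theorem summable_Gamma_div {x c : ℝ} (hx : 0 < x) (hc : 0 < c) :
    Summable fun n : ℕ => Real.Gamma (x + n) / Real.Gamma (x + c + 1 + n) :=
  summable_of_sum_range_le (Gamma_div_nonneg hx (by positivity)) (sum_range_Gamma_div_le hx hc)

theorem tsum_Gamma_div_le {x c : ℝ} (hx : 0 < x) (hc : 0 < c) :
    ∑' n : ℕ, Real.Gamma (x + n) / Real.Gamma (x + c + 1 + n) ≤
      Real.Gamma x / Real.Gamma (x + c) / c :=
  Real.tsum_le_of_sum_range_le (Gamma_div_nonneg hx (by positivity)) (sum_range_Gamma_div_le hx hc)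

/-- The summand of `Ftilde`, with the Pochhammer symbols written as quotients of Gamma values. -/
noncomputable def gammaTerm (α β : ℝ) (p : ℕ × ℕ) : ℝ :=
  Real.Gamma (α + p.1) * (Real.Gamma (β + p.2) / Real.Gamma (β + (α + p.1) + 1 + p.2))

theorem gammaTerm_nonneg {α β : ℝ} (hα : 0 < α) (hβ : 0 < β) (p : ℕ × ℕ) :
    0 ≤ gammaTerm α β p :=
  mul_nonneg (Real.Gamma_pos_of_pos (by positivity)).le (Gamma_div_nonneg hβ (by positivity) _)

theorem summable_gammaTerm {α β : ℝ} (hα : 0 < α) (hβ : 0 < β) :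
    Summable (gammaTerm α β) := by
  rw [summable_prod_of_nonneg (gammaTerm_nonneg hα hβ)]
  refine ⟨fun m => ?_, ?_⟩
  · have hm : 0 < α + (m : ℝ) := by positivity
    exact (summable_Gamma_div hβ hm).mul_left (Real.Gamma (α + m))
  refine Summable.of_nonneg_of_le (fun m => tsum_nonneg fun n => gammaTerm_nonneg hα hβ (m, n))
    (fun m => ?_) ((summable_Gamma_div hα hβ).mul_left (Real.Gamma β * ((α + β) / α)))
  have hm : 0 < α + (m : ℝ) := by positivity
  have hm' : 0 < α + β + (m : ℝ) := by positivity
  have g1 := Real.Gamma_pos_of_pos hm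
  have g2 := Real.Gamma_pos_of_pos hm'
  have g3 := Real.Gamma_pos_of_pos hβ
  simp only [gammaTerm]
  rw [tsum_mul_left]
  refine (mul_le_mul_of_nonneg_left (tsum_Gamma_div_le hβ hm) g1.le).trans ?_
  rw [add_right_comm (α + β) 1, Real.Gamma_add_one hm'.ne',
    show β + (α + m) = α + β + (m : ℝ) by ring]
  have h : 1 / (α + (m : ℝ)) ≤ (α + β) / α / (α + β + m) := by
    rw [div_div, div_le_div_iff₀ hm (by positivity)]
    nlinarith [mul_nonneg hβ.le (Nat.cast_nonneg (α := ℝ) m)]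
  calc Real.Gamma (α + m) * (Real.Gamma β / Real.Gamma (α + β + m) / (α + m))
      = Real.Gamma (α + m) * Real.Gamma β / Real.Gamma (α + β + m) * (1 / (α + m)) := by
        field_simp
    _ ≤ Real.Gamma (α + m) * Real.Gamma β / Real.Gamma (α + β + m) *
          ((α + β) / α / (α + β + m)) := by gcongr
    _ = _ := by field_simp

theorem Ftilde_eq_tsum_gammaTerm {α β : ℝ} (hα : 0 < α) (hβ : 0 < β) :
    Ftilde α β = ∑' p, gammaTerm α β p := by
  rw [Ftilde, ← tsum_mul_left]
  refine tsum_congr fun p => ?_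
  have h : 0 < α + β + 1 := by positivity
  rw [gammaTerm, show β + (α + p.1) + 1 + p.2 = α + β + 1 + ((p.1 + p.2 : ℕ) : ℝ) by
    push_cast; ring, Gamma_add_eq_poch_mul hα, Gamma_add_eq_poch_mul hβ, Gamma_add_eq_poch_mul h,
    div_mul_div_comm, mul_div_assoc']
  congr 1 <;> ring

theorem gammaTerm_lt_gammaTerm {α α' β : ℝ} (hα : 0 < α) (h : α < α') (hβ : 0 < β)
    (p : ℕ × ℕ) : gammaTerm α' β p < gammaTerm α β p := by
  have hm : 0 < α + (p.1 : ℝ) := by positivity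
  have hn : 0 < β + (p.2 : ℝ) := by positivity
  have key := mul_lt_mul_of_pos_left
    (Gamma_div_Gamma_add_lt hm (add_lt_add_left h (p.1 : ℝ)) (add_pos hn one_pos))
    (Real.Gamma_pos_of_pos hn)
  have e (x : ℝ) : gammaTerm x β p = Real.Gamma (β + p.2) *
      (Real.Gamma (x + p.1) / Real.Gamma (x + p.1 + (β + p.2 + 1))) := by
    rw [gammaTerm, show β + (x + p.1) + 1 + p.2 = x + p.1 + (β + p.2 + 1) by ring]
    ring
  rwa [e, e]

theorem Ftilde_strictAnti_left {α α' β : ℝ} (hα : 0 < α) (h : α < α') (hβ : 0 < β) :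
    Ftilde α' β < Ftilde α β := by
  have hα' := hα.trans h
  rw [Ftilde_eq_tsum_gammaTerm hα hβ, Ftilde_eq_tsum_gammaTerm hα' hβ]
  exact (summable_gammaTerm hα' hβ).tsum_lt_tsum (i := (0, 0))
    (fun p => (gammaTerm_lt_gammaTerm hα h hβ p).le)
    (gammaTerm_lt_gammaTerm hα h hβ _) (summable_gammaTerm hα hβ)

theorem Ftilde_comm_s3 (α β : ℝ) : Ftilde α β = Ftilde β α := by
  rw [Ftilde, Ftilde, ← (Equiv.prodComm ℕ ℕ).tsum_eq]
  simp only [Equiv.prodComm_apply, Prod.fst_swap, Prod.snd_swap]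
  congr 1
  · rw [mul_comm (Real.Gamma α), add_comm α β]
  · refine tsum_congr fun p => ?_
    rw [mul_comm (poch α _), add_comm α β, add_comm p.2]

theorem Ftilde_one_sub_lt {α β : ℝ} (hα : 0 < α) (hβ : 0 < β) (h : α + β < 1) :
    Ftilde (1 - α) (1 - β) < Ftilde α β :=
  calc Ftilde (1 - α) (1 - β) < Ftilde β (1 - β) :=
        Ftilde_strictAnti_left hβ (by linarith) (by linarith)
    _ = Ftilde (1 - β) β := Ftilde_comm_s3 _ _
    _ < Ftilde α β := Ftilde_strictAnti_left hα (by linarith) hβ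

theorem stmt3 (α β : ℝ) (hα0 : 0 < α) (hα1 : α < 1) (hβ0 : 0 < β) (hβ1 : β < 1) :
    (Ftilde α β ≠ Ftilde (1 - α) (1 - β) ↔ α + β ≠ 1) ∧
    (α + β < 1 → Ftilde (1 - α) (1 - β) < Ftilde α β) ∧
    (1 < α + β → Ftilde α β < Ftilde (1 - α) (1 - β)) ∧
    (α + β = 1 → Ftilde α β = Ftilde (1 - α) (1 - β)) := by
  have hlt : α + β < 1 → Ftilde (1 - α) (1 - β) < Ftilde α β := Ftilde_one_sub_lt hα0 hβ0
  have hgt : 1 < α + β → Ftilde α β < Ftilde (1 - α) (1 - β) := fun h => by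
    simpa using Ftilde_one_sub_lt (α := 1 - α) (β := 1 - β) (by linarith) (by linarith)
      (by linarith)
  have heq : α + β = 1 → Ftilde α β = Ftilde (1 - α) (1 - β) := fun h => by
    rw [Ftilde_comm_s3, show 1 - α = β by linarith, show 1 - β = α by linarith]
  refine ⟨⟨fun hne h => hne (heq h), fun hne => ?_⟩, hlt, hgt, heq⟩
  rcases lt_or_gt_of_ne hne with h | h
  · exact (hlt h).ne'
  · exact (hgt h).ne
end

section
/- For all positive real numbers α and β, the hypergeometric series F(α,β,α+β+1;1) = Σ_{n≥0} (α,n)(β,n)/((α+β+1,n)(1,n)) converges and equals ((α+β)/(αβ))·Γ(α+β)/(Γ(α)Γ(β)), i.e. ((α+β)/(αβ))·B(α,β)^{−1}, where B(α,β) = Γ(α)Γ(β)/Γ(α+β) is the Beta function. -/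
theorem poch_succ (x : ℝ) (n : ℕ) : poch x (n + 1) = poch x n * (x + n) :=
  Finset.prod_range_succ _ _

theorem poch_pos {x : ℝ} (hx : 0 < x) (n : ℕ) : 0 < poch x n :=
  Finset.prod_pos fun _ _ => by positivity

theorem mul_poch_add_one (x : ℝ) (n : ℕ) : x * poch (x + 1) n = poch x (n + 1) := by
  simp only [poch, Finset.prod_range_succ', Nat.cast_zero, add_zero, Nat.cast_succ]
  rw [mul_comm]
  congr 1
  exact Finset.prod_congr rfl fun i _ => by ring

theorem poch_one (n : ℕ) : poch 1 n = n.factorial := by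
  induction n with
  | zero => simp [poch]
  | succ n ih => rw [poch_succ, ih, Nat.factorial_succ]; push_cast; ring

/-- The hypergeometric series `F(α, β, α + β + 1; 1)` has closed-form partial sums. -/
theorem sum_range_succ_hypergeometric {α β : ℝ} (hα : 0 < α) (hβ : 0 < β) (N : ℕ) :
    ∑ n ∈ Finset.range (N + 1), poch α n * poch β n / (poch (α + β + 1) n * poch 1 n) =
      ((α + β) / (α * β)) *
        (poch α (N + 1) * poch β (N + 1) / (poch (α + β) (N + 1) * N.factorial)) := by
  induction N with
  | zero =>
    simp [poch]
    field_simp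
  | succ N ih =>
    have hc : poch (α + β + 1) (N + 1) = poch (α + β) (N + 1) * (α + β + (N + 1)) / (α + β) := by
      rw [eq_div_iff (by positivity), mul_comm, mul_poch_add_one, poch_succ _ (N + 1)]
      push_cast
      ring
    have hp : poch (α + β) (N + 1) ≠ 0 := (poch_pos (by positivity) _).ne'
    have hf : (N.factorial : ℝ) ≠ 0 := by positivity
    have hs : α + β + ((N : ℝ) + 1) ≠ 0 := by positivity
    rw [Finset.sum_range_succ, ih, hc, poch_one, poch_succ α (N + 1), poch_succ β (N + 1),
      poch_succ (α + β) (N + 1), Nat.factorial_succ]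
    push_cast
    field_simp
    ring

theorem GammaSeq_eq_div_poch (x : ℝ) (n : ℕ) :
    Real.GammaSeq x n = (n : ℝ) ^ x * n.factorial / poch x (n + 1) := rfl

theorem hasSum_hypergeometric {α β : ℝ} (hα : 0 < α) (hβ : 0 < β) :
    HasSum (fun n : ℕ => poch α n * poch β n / (poch (α + β + 1) n * poch 1 n))
      (((α + β) / (α * β)) * (Real.Gamma (α + β) / (Real.Gamma α * Real.Gamma β))) := by
  have hnonneg (n : ℕ) : 0 ≤ poch α n * poch β n / (poch (α + β + 1) n * poch 1 n) := by
    have := poch_pos hα n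
    have := poch_pos hβ n
    have := poch_pos (show 0 < α + β + 1 by positivity) n
    have := poch_pos one_pos n
    positivity
  rw [hasSum_iff_tendsto_nat_of_nonneg hnonneg, ← Filter.tendsto_add_atTop_iff_nat 1]
  have hΓ : Real.Gamma α * Real.Gamma β ≠ 0 :=
    (mul_pos (Real.Gamma_pos_of_pos hα) (Real.Gamma_pos_of_pos hβ)).ne'
  refine (((Real.GammaSeq_tendsto_Gamma (α + β)).div ((Real.GammaSeq_tendsto_Gamma α).mul
    (Real.GammaSeq_tendsto_Gamma β)) hΓ).const_mul ((α + β) / (α * β))).congr' ?_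
  filter_upwards [Filter.eventually_gt_atTop 0] with N hN
  have hN' : (0 : ℝ) < N := by exact_mod_cast hN
  rw [sum_range_succ_hypergeometric hα hβ]
  congr 1
  simp only [Pi.div_apply, GammaSeq_eq_div_poch]
  rw [Real.rpow_add hN']
  have := poch_pos hα (N + 1)
  have := poch_pos hβ (N + 1)
  have := poch_pos (add_pos hα hβ) (N + 1)
  have := Real.rpow_pos_of_pos hN' α
  have := Real.rpow_pos_of_pos hN' β
  have : (0 : ℝ) < N.factorial := by positivity
  field_simp

theorem stmt5 (α β : ℝ) (hα : 0 < α) (hβ : 0 < β) :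
    Summable (fun n : ℕ => poch α n * poch β n / (poch (α + β + 1) n * poch 1 n)) ∧
    ∑' n : ℕ, poch α n * poch β n / (poch (α + β + 1) n * poch 1 n) =
      ((α + β) / (α * β)) * (Real.Gamma (α + β) / (Real.Gamma α * Real.Gamma β)) :=
  ⟨(hasSum_hypergeometric hα hβ).summable, (hasSum_hypergeometric hα hβ).tsum_eq⟩
end

section
/- For every complex number α with 0 < Re(α) < 1, one has F̃(α,α) − F̃(1−α,1−α) = 3·(G̃(α,α) − G̃(1−α,1−α)). -/
/-- F̃(α,β) for complex parameters with positive real parts. -/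
noncomputable def cFtilde (α β : ℂ) : ℂ :=
  (Complex.Gamma α * Complex.Gamma β / Complex.Gamma (α + β + 1)) *
    ∑' p : ℕ × ℕ, cpoch α p.1 * cpoch β p.2 / cpoch (α + β + 1) (p.1 + p.2)

/-- G̃(α,β) for complex parameters with positive real parts. -/
noncomputable def cGtilde (α β : ℂ) : ℂ :=
  (Complex.Gamma α * Complex.Gamma β / Complex.Gamma (α + β + 1)) *
    ∑' n : ℕ, cpoch α n * cpoch β n / cpoch (α + β + 1) (2 * n)

/-- The general term `(a, m) (a, n) / (2 a + 1, m + n)` of the diagonal double series. -/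
noncomputable def pochTerm {K : Type*} [Field K] (a : K) (m n : ℕ) : K :=
  (ascPochhammer K m).eval a * (ascPochhammer K n).eval a /
    (ascPochhammer K (m + n)).eval (2 * a + 1)

theorem cpoch_eq_ascPochhammer_eval (a : ℂ) (n : ℕ) :
    cpoch a n = (ascPochhammer ℂ n).eval a := by
  induction n with
  | zero => simp [cpoch]
  | succ n ih => rw [ascPochhammer_succ_eval, ← ih, cpoch, cpoch, Finset.prod_range_succ]

theorem pochTerm_comm {K : Type*} [Field K] (a : K) (m n : ℕ) :
    pochTerm a m n = pochTerm a n m := by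
  rw [pochTerm, pochTerm, mul_comm, add_comm m n]

theorem pochTerm_succ_left {K : Type*} [Field K] (a : K) (m n : ℕ) :
    pochTerm a (m + 1) n = pochTerm a m n * ((a + m) / (2 * a + 1 + (m + n : ℕ))) := by
  rw [pochTerm, pochTerm, add_right_comm m 1 n, ascPochhammer_succ_eval, ascPochhammer_succ_eval,
    div_mul_div_comm]
  ring

theorem sum_range_pochTerm {K : Type*} [Field K] {a : K} (k : ℕ) (hk : a + k ≠ 0)
    (h : ∀ n : ℕ, 2 * a + 1 + n ≠ 0) (j N : ℕ) :
    ∑ i ∈ Finset.range N, pochTerm a (i + j) k =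
      (2 * a + j + k) / (a + k) * pochTerm a j k -
        (2 * a + (N + j : ℕ) + k) / (a + k) * pochTerm a (N + j) k := by
  induction N with
  | zero => simp
  | succ N ih =>
    rw [Finset.sum_range_succ, ih, add_right_comm N 1 j, pochTerm_succ_left]
    have h' := h (N + j + k)
    push_cast at h' ⊢
    field_simp
    ring

theorem pochTerm_pos {s : ℝ} (hs : 0 < s) (m n : ℕ) : 0 < pochTerm s m n :=
  div_pos (mul_pos (ascPochhammer_pos m s hs) (ascPochhammer_pos n s hs))
    (ascPochhammer_pos _ _ (by positivity))

theorem sum_range_pochTerm_le {s : ℝ} (hs : 0 < s) (k N : ℕ) :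
    ∑ i ∈ Finset.range N, pochTerm s i k ≤ 2 * pochTerm s 0 k := by
  have h := sum_range_pochTerm (a := s) k (by positivity) (fun n => by positivity) 0 N
  simp only [add_zero, Nat.cast_zero] at h
  have h1 : 0 ≤ (2 * s + (N : ℕ) + k) / (s + k) * pochTerm s N k :=
    mul_nonneg (by positivity) (pochTerm_pos hs _ _).le
  have h2 : (2 * s + k) / (s + k) ≤ 2 := by
    rw [div_le_iff₀ (by positivity)]
    have : (0 : ℝ) ≤ k := k.cast_nonneg
    linarith
  have := mul_le_mul_of_nonneg_right h2 (pochTerm_pos hs 0 k).le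
  linarith

theorem summable_pochTerm_real {s : ℝ} (hs : 0 < s) :
    Summable fun p : ℕ × ℕ => pochTerm s p.1 p.2 := by
  have hpos := fun m n => (pochTerm_pos hs m n).le
  have hcol : ∀ k, Summable fun i => pochTerm s i k := fun k =>
    summable_of_sum_range_le (hpos · k) (sum_range_pochTerm_le hs k)
  rw [← (Equiv.prodComm ℕ ℕ).summable_iff]
  refine (summable_prod_of_nonneg fun p => hpos _ _).2 ⟨hcol, ?_⟩
  refine Summable.of_nonneg_of_le (fun k => tsum_nonneg (hpos · k))
    (fun k => Real.tsum_le_of_sum_range_le (hpos · k) (sum_range_pochTerm_le hs k)) ?_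
  simp_rw [pochTerm_comm s 0]
  exact (hcol 0).mul_left 2

theorem norm_le_re_mul_exp {z : ℂ} (hz : 0 < z.re) :
    ‖z‖ ≤ z.re * Real.exp (z.im ^ 2 / z.re ^ 2) := by
  have h1 : ‖z‖ ≤ z.re * (z.im ^ 2 / z.re ^ 2 + 1) := by
    rw [Complex.norm_def, Complex.normSq_apply]
    refine Real.sqrt_le_iff.2 ⟨by positivity, ?_⟩
    have : (z.re * (z.im ^ 2 / z.re ^ 2 + 1)) ^ 2 =
        z.re * z.re + z.im * z.im + (z.im ^ 2 + z.im ^ 4 / z.re ^ 2) := by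
      field_simp
      ring
    rw [this]
    exact le_add_of_nonneg_right (by positivity)
  exact h1.trans (mul_le_mul_of_nonneg_left (Real.add_one_le_exp _) hz.le)

theorem exists_norm_ascPochhammer_eval_le {a : ℂ} (ha : 0 < a.re) :
    ∃ C, ∀ n, ‖(ascPochhammer ℂ n).eval a‖ ≤ C * (ascPochhammer ℝ n).eval a.re := by
  have hsum : Summable fun i : ℕ => a.im ^ 2 / (a.re + i) ^ 2 := by
    have h := (Real.summable_one_div_nat_add_rpow a.re 2).2 one_lt_two
    refine (h.mul_left (a.im ^ 2)).congr fun i => ?_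
    rw [abs_of_pos (by positivity), Real.rpow_two, mul_one_div, add_comm]
  have key : ∀ n, ‖(ascPochhammer ℂ n).eval a‖ ≤
      Real.exp (∑ i ∈ Finset.range n, a.im ^ 2 / (a.re + i) ^ 2) *
        (ascPochhammer ℝ n).eval a.re := fun n => by
    induction n with
    | zero => simp
    | succ n ih =>
      have h := norm_le_re_mul_exp (z := a + n) (by simp; positivity)
      simp only [Complex.add_re, Complex.natCast_re, Complex.add_im, Complex.natCast_im,
        add_zero] at h
      rw [ascPochhammer_succ_eval, ascPochhammer_succ_eval, norm_mul, Finset.sum_range_succ,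
        Real.exp_add]
      refine (mul_le_mul ih h (norm_nonneg _) ((norm_nonneg _).trans ih)).trans_eq ?_
      ring
  refine ⟨Real.exp (∑' i : ℕ, a.im ^ 2 / (a.re + i) ^ 2), fun n => (key n).trans ?_⟩
  have := (ascPochhammer_pos n a.re ha).le
  gcongr
  exact hsum.sum_le_tsum _ fun i _ => by positivity

theorem ascPochhammer_eval_re_le_norm {a : ℂ} (ha : 0 < a.re) (n : ℕ) :
    (ascPochhammer ℝ n).eval a.re ≤ ‖(ascPochhammer ℂ n).eval a‖ := by
  induction n with
  | zero => simp
  | succ n ih =>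
    rw [ascPochhammer_succ_eval, ascPochhammer_succ_eval, norm_mul]
    refine mul_le_mul ih ?_ (by positivity) (norm_nonneg _)
    simpa using Complex.re_le_norm (a + n)

theorem summable_pochTerm {a : ℂ} (ha : 0 < a.re) :
    Summable fun p : ℕ × ℕ => pochTerm a p.1 p.2 := by
  obtain ⟨C, hC⟩ := exists_norm_ascPochhammer_eval_le ha
  refine Summable.of_norm_bounded ((summable_pochTerm_real ha).mul_left (C * C)) fun p => ?_
  have h := ascPochhammer_eval_re_le_norm (a := 2 * a + 1) (by simp; positivity) (p.1 + p.2)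
  have hre : (2 * a + 1).re = 2 * a.re + 1 := by simp
  rw [hre] at h
  rw [pochTerm, pochTerm, norm_div, norm_mul, ← mul_div_assoc]
  have hnum := mul_le_mul (hC p.1) (hC p.2) (norm_nonneg _) ((norm_nonneg _).trans (hC p.1))
  rw [mul_mul_mul_comm] at hnum
  exact div_le_div₀ ((mul_nonneg (norm_nonneg _) (norm_nonneg _)).trans hnum) hnum
    (ascPochhammer_pos _ _ (by positivity)) h

/-- If `∑ f` converges absolutely and `(n + c) f n` has a limit, the limit is zero. -/
theorem Summable.eq_zero_of_tendsto_add_mul {f : ℕ → ℂ} (hf : Summable f) {c L : ℂ}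
    (h : Filter.Tendsto (fun n : ℕ => ((n : ℂ) + c) * f n) Filter.atTop (nhds L)) : L = 0 := by
  by_contra hL
  have h1 : Filter.Tendsto (fun n : ℕ => (n : ℂ) * f n) Filter.atTop (nhds L) := by
    have := h.sub (hf.tendsto_atTop_zero.const_mul c)
    simpa [add_mul] using this
  refine Real.not_summable_natCast_inv ?_
  have h2 : ∀ᶠ n : ℕ in Filter.atTop, ‖L‖ / 2 < ‖(n : ℂ) * f n‖ :=
    h1.norm.eventually_const_lt (half_lt_self (norm_pos_iff.2 hL : 0 < ‖L‖))
  refine Summable.of_norm_bounded_eventually_nat (hf.norm.mul_left (2 / ‖L‖)) ?_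
  filter_upwards [h2, Filter.eventually_gt_atTop 0] with n hn hn0
  have : (0 : ℝ) < n := Nat.cast_pos.2 hn0
  have hL' : 0 < ‖L‖ := norm_pos_iff.2 hL
  rw [norm_mul, Complex.norm_natCast] at hn
  rw [Real.norm_of_nonneg (by positivity), inv_le_iff_one_le_mul₀ this, div_mul_eq_mul_div,
    div_mul_eq_mul_div, one_le_div hL']
  linarith

theorem tsum_pochTerm_add_self {a : ℂ} (ha : 0 < a.re) (k : ℕ) :
    ∑' i, pochTerm a (i + k) k = 2 * pochTerm a k k := by
  have hak : a + k ≠ 0 := fun h => by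
    have := congrArg Complex.re h
    simp at this
    have : (0 : ℝ) ≤ k := k.cast_nonneg
    linarith
  have h2a : ∀ n : ℕ, 2 * a + 1 + n ≠ 0 := fun n h => by
    have := congrArg Complex.re h
    simp at this
    have : (0 : ℝ) ≤ n := n.cast_nonneg
    linarith
  have hs : Summable fun i => pochTerm a (i + k) k :=
    (summable_pochTerm ha).comp_injective (i := fun i => (i + k, k)) fun i j h => by simpa using h
  have hlim := hs.hasSum.tendsto_sum_nat
  simp_rw [sum_range_pochTerm k hak h2a k] at hlim
  have hlim' := (hlim.const_sub ((2 * a + k + k) / (a + k) * pochTerm a k k)).const_mul (a + k)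
  have h0 := hs.eq_zero_of_tendsto_add_mul (c := 2 * a + k + k) (hlim'.congr fun n => by
    push_cast
    field_simp
    ring)
  rw [← sub_eq_zero.1 ((mul_eq_zero.1 h0).resolve_left hak)]
  field_simp
  ring

theorem tsum_pochTerm_prod {a : ℂ} (ha : 0 < a.re) :
    ∑' p : ℕ × ℕ, pochTerm a p.1 p.2 = 3 * ∑' n, pochTerm a n n := by
  have hs := summable_pochTerm ha
  have hlow : Summable fun p : ℕ × ℕ => if p.1 ≤ p.2 then pochTerm a p.2 p.1 else 0 := by
    refine (hs.indicator {p | p.1 ≤ p.2}).congr fun p => ?_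
    simp [Set.indicator_apply, pochTerm_comm a p.1]
  have hup : Summable fun p : ℕ × ℕ => if p.2 ≤ p.1 then pochTerm a p.1 p.2 else 0 :=
    hlow.prod_symm
  have hdiag : Summable fun p : ℕ × ℕ => if p.2 = p.1 then pochTerm a p.1 p.1 else 0 := by
    refine (hs.indicator {p | p.2 = p.1}).congr fun p => ?_
    by_cases h : p.2 = p.1 <;> simp [h]
  have hlow_sum : ∑' p : ℕ × ℕ, (if p.1 ≤ p.2 then pochTerm a p.2 p.1 else 0) =
      2 * ∑' n, pochTerm a n n := by
    rw [hlow.tsum_prod, ← tsum_mul_left]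
    refine tsum_congr fun k => ?_
    rw [← (hlow.prod_factor k).sum_add_tsum_nat_add k, Finset.sum_eq_zero, zero_add]
    · simpa using tsum_pochTerm_add_self ha k
    · intro i hi
      simp [Finset.mem_range.1 hi]
  have hup_sum : ∑' p : ℕ × ℕ, (if p.2 ≤ p.1 then pochTerm a p.1 p.2 else 0) =
      2 * ∑' n, pochTerm a n n := by
    rw [← hlow_sum]
    exact (Equiv.prodComm ℕ ℕ).tsum_eq
      fun p : ℕ × ℕ => if p.1 ≤ p.2 then pochTerm a p.2 p.1 else 0
  have hdiag_sum : ∑' p : ℕ × ℕ, (if p.2 = p.1 then pochTerm a p.1 p.1 else 0) =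
      ∑' n, pochTerm a n n := by
    rw [hdiag.tsum_prod]
    exact tsum_congr fun k => by simp
  have hsplit : ∀ p : ℕ × ℕ, pochTerm a p.1 p.2 =
      (if p.1 ≤ p.2 then pochTerm a p.2 p.1 else 0) +
        (if p.2 ≤ p.1 then pochTerm a p.1 p.2 else 0) -
          (if p.2 = p.1 then pochTerm a p.1 p.1 else 0) := fun p => by
    rcases lt_trichotomy p.1 p.2 with h | h | h
    · simp [h.le, h.not_ge, h.ne', pochTerm_comm a p.1]
    · simp [h]
    · simp [h.le, h.not_ge, h.ne]
  have h := (hlow.hasSum.add hup.hasSum).sub hdiag.hasSum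
  rw [hlow_sum, hup_sum, hdiag_sum] at h
  rw [tsum_congr hsplit, h.tsum_eq]
  ring

theorem cFtilde_self {a : ℂ} (ha : 0 < a.re) : cFtilde a a = 3 * cGtilde a a := by
  have h := tsum_pochTerm_prod ha
  simp only [pochTerm, two_mul] at h
  simp only [cFtilde, cGtilde, cpoch_eq_ascPochhammer_eval, two_mul, h]
  ring

theorem stmt9 (α : ℂ) (h0 : 0 < α.re) (h1 : α.re < 1) :
    cFtilde α α - cFtilde (1 - α) (1 - α) =
      3 * (cGtilde α α - cGtilde (1 - α) (1 - α)) := by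
  rw [cFtilde_self h0, cFtilde_self (a := 1 - α) (by simpa using h1), mul_sub]
end

section
/- Let K be a finite field with q elements, N a positive integer dividing q−1, ζ ∈ K an element of multiplicative order exactly N, and k̄ a fixed algebraic closure of K. Fix n ≥ 1, let K_n ⊆ k̄ be the unique subfield with q^n elements, and let r be an integer. Then for every u ∈ K_n, the cardinality of {x ∈ k̄ : x^N = u and x^{q^n} = ζ^r·x} equals: 1 if u = 0; N if u ≠ 0 and u^{(q^n−1)/N} = ζ^r; and 0 if u ≠ 0 and u^{(q^n−1)/N} ≠ ζ^r. -/
/-- Over an algebraically closed field containing a primitive `N`-th root of unity, a nonzero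
element has exactly `N` distinct `N`-th roots. -/
theorem IsPrimitiveRoot.ncard_setOf_pow_eq {F : Type*} [Field F] [IsAlgClosed F] {z u : F} {N : ℕ}
    (hz : IsPrimitiveRoot z N) (hN : 0 < N) (hu : u ≠ 0) :
    Set.ncard {x : F | x ^ N = u} = N := by
  classical
  have hset : {x : F | x ^ N = u} = ((Polynomial.nthRoots N u).toFinset : Set F) := by
    ext x
    simp [Polynomial.mem_nthRoots hN]
  rw [hset, Set.ncard_coe_finset, Multiset.toFinset_card_of_nodup (hz.nthRoots_nodup hu),
    hz.card_nthRoots, if_pos (IsAlgClosed.exists_pow_nat_eq u hN)]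

open scoped Classical in
theorem stmt12 (K kbar : Type*) [Field K] [Fintype K] [Field kbar] [Algebra K kbar]
    [IsAlgClosure K kbar]
    (q N : ℕ) (hq : Fintype.card K = q) (hN : 0 < N) (hNq : N ∣ q - 1)
    (ζ : K) (hζ : orderOf ζ = N)
    (n : ℕ) (hn : 1 ≤ n) (r : ℤ)
    (u : kbar) (hu : u ^ q ^ n = u) :
    Set.ncard {x : kbar | x ^ N = u ∧ x ^ q ^ n = algebraMap K kbar ζ ^ r * x} =
      if u = 0 then 1
      else if u ^ ((q ^ n - 1) / N) = algebraMap K kbar ζ ^ r then N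
      else 0 := by
  have : IsAlgClosed kbar := IsAlgClosure.isAlgClosed K
  have hz : IsPrimitiveRoot (algebraMap K kbar ζ) N :=
    (IsPrimitiveRoot.iff_orderOf.mpr hζ).map_of_injective (algebraMap K kbar).injective
  have hqn : 0 < q ^ n := pow_pos (hq ▸ Fintype.card_pos) n
  split_ifs with h0 h1
  · subst h0
    rw [Set.ncard_eq_one]
    refine ⟨0, ?_⟩
    ext x
    constructor
    · rintro ⟨hx, -⟩
      exact eq_zero_of_pow_eq_zero hx
    · rintro rfl
      exact ⟨zero_pow hN.ne', by rw [zero_pow hqn.ne', mul_zero]⟩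
  all_goals
    have hdvd : N ∣ q ^ n - 1 := hNq.trans (by simpa using Nat.sub_dvd_pow_sub_pow q 1 n)
    have hexp : q ^ n = N * ((q ^ n - 1) / N) + 1 := by
      rw [Nat.mul_div_cancel' hdvd, Nat.sub_add_cancel hqn]
    have hpow : ∀ x : kbar, x ^ N = u → x ^ q ^ n = u ^ ((q ^ n - 1) / N) * x := by
      rintro x rfl
      rw [← pow_mul, ← pow_succ, ← hexp]
  · refine Eq.trans (congrArg Set.ncard ?_) (hz.ncard_setOf_pow_eq hN h0)
    ext x
    exact ⟨And.left, fun hx => ⟨hx, h1 ▸ hpow x hx⟩⟩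
  · convert Set.ncard_empty kbar
    refine Set.eq_empty_of_forall_notMem ?_
    rintro x ⟨hx, hx'⟩
    have hx0 : x ≠ 0 := by
      rintro rfl
      exact h0 (by rw [← hx, zero_pow hN.ne'])
    exact h1 (mul_right_cancel₀ hx0 ((hpow x hx).symm.trans hx'))
end

section
/- Let K be a finite field with q elements, N a positive integer dividing q−1, ζ ∈ K an element of multiplicative order exactly N, and k̄ a fixed algebraic closure of K. Fix n ≥ 1, let K_n ⊆ k̄ be the unique subfield with q^n elements, and let r, s be integers. Then the number of pairs (x,y) ∈ k̄² satisfying x^N + y^N = 1, x^{q^n} = ζ^r·x and y^{q^n} = ζ^s·y equals N²·#{(u,v) ∈ K_n^*×K_n^* : u+v = 1, u^{(q^n−1)/N} = ζ^r, v^{(q^n−1)/N} = ζ^s} + N·δ(r ≡ 0 mod N) + N·δ(s ≡ 0 mod N), where δ(P) is 1 if the statement P is true and 0 otherwise. -/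
theorem pow_eq_mul_self_iff_of_ne_zero {F : Type*} [Field F] {x c : F} (hx : x ≠ 0) (m N : ℕ) :
    x ^ (N * m + 1) = c * x ↔ (x ^ N) ^ m = c := by
  rw [pow_succ, ← pow_mul]
  exact mul_left_inj' hx

theorem pow_eq_self_of_pow_eq {F : Type*} [Field F] {u c : F} {m N : ℕ}
    (hc : c ^ N = 1) (h : u ^ m = c) : u ^ (N * m + 1) = u := by
  rw [pow_succ, mul_comm N, pow_mul, h, hc, one_mul]

/-- Each pair of nonzero elements has exactly `N ^ 2` pairs of `N`-th roots, in terms of a set of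
pairs and its preimage under the coordinatewise `N`-th power map. -/
theorem ncard_preimage_pow_prod {F : Type*} [Field F] [IsAlgClosed F] {z : F} {N : ℕ}
    (hN : 0 < N) (hz : IsPrimitiveRoot z N) (T : Set (F × F))
    (hT : ∀ p ∈ T, p.1 ≠ 0 ∧ p.2 ≠ 0) (hfin : T.Finite) :
    {p : F × F | (p.1 ^ N, p.2 ^ N) ∈ T}.ncard = N ^ 2 * T.ncard ∧
      {p : F × F | (p.1 ^ N, p.2 ^ N) ∈ T}.Finite := by
  choose ρ hρ using fun u : F => IsAlgClosed.exists_pow_nat_eq u hN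
  set R : Set F := (Polynomial.nthRootsFinset N (1 : F) : Set F) with hR
  have hmem : ∀ a, a ∈ R ↔ a ^ N = 1 := fun a => by
    rw [hR, Finset.mem_coe, Polynomial.mem_nthRootsFinset hN]
  have hcard : R.ncard = N := by
    rw [hR, Set.ncard_coe_finset, hz.card_nthRootsFinset]
  have hρ0 : ∀ u, u ≠ 0 → ρ u ≠ 0 := fun u hu h => hu (by rw [← hρ u, h, zero_pow hN.ne'])
  let f : (F × F) × (F × F) → F × F := fun w => (ρ w.1.1 * w.2.1, ρ w.1.2 * w.2.2)
  have hpow : ∀ w ∈ T ×ˢ (R ×ˢ R), ((f w).1 ^ N, (f w).2 ^ N) = w.1 := by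
    rintro ⟨⟨u, v⟩, a, b⟩ ⟨-, ha, hb⟩
    simp only [f, mul_pow, hρ, (hmem a).1 ha, (hmem b).1 hb, mul_one]
  have himage : {p : F × F | (p.1 ^ N, p.2 ^ N) ∈ T} = f '' (T ×ˢ (R ×ˢ R)) := by
    ext ⟨x, y⟩
    constructor
    · intro h
      obtain ⟨hx, hy⟩ := hT _ h
      refine ⟨((x ^ N, y ^ N), (x / ρ (x ^ N), y / ρ (y ^ N))), ⟨h, ?_, ?_⟩, ?_⟩
      · exact (hmem _).2 (by rw [div_pow, hρ]; exact div_self hx)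
      · exact (hmem _).2 (by rw [div_pow, hρ]; exact div_self hy)
      · exact Prod.ext (mul_div_cancel₀ _ (hρ0 _ hx)) (mul_div_cancel₀ _ (hρ0 _ hy))
    · rintro ⟨w, hw, h⟩
      rw [← h, Set.mem_ofPred_eq, hpow w hw]
      exact hw.1
  have hinj : Set.InjOn f (T ×ˢ (R ×ˢ R)) := by
    intro w hw w' hw' h
    have h1 : w.1 = w'.1 := by rw [← hpow w hw, ← hpow w' hw', h]
    obtain ⟨hu, hv⟩ := hT _ hw'.1
    simp only [f, h1, Prod.mk.injEq] at h
    exact Prod.ext h1 (Prod.ext (mul_left_cancel₀ (hρ0 _ hu) h.1)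
      (mul_left_cancel₀ (hρ0 _ hv) h.2))
  have hRfin : R.Finite := Finset.finite_toSet _
  rw [himage]
  refine ⟨?_, (hfin.prod (hRfin.prod hRfin)).image f⟩
  rw [hinj.ncard_image, Set.ncard_prod, Set.ncard_prod, hcard]
  ring

theorem ncard_setOf_pow_eq_one_and {F : Type*} [Field F] {z : F} {N : ℕ}
    (hN : 0 < N) (hz : IsPrimitiveRoot z N) (r : ℤ) :
    {a : F | a ^ N = 1 ∧ z ^ r = 1}.ncard = N * (if (r : ZMod N) = 0 then 1 else 0) ∧
      {a : F | a ^ N = 1 ∧ z ^ r = 1}.Finite := by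
  have hr : z ^ r = 1 ↔ (r : ZMod N) = 0 := by
    rw [hz.zpow_eq_one_iff_dvd, ZMod.intCast_zmod_eq_zero_iff_dvd]
  have hset : {a : F | a ^ N = 1} = (Polynomial.nthRootsFinset N (1 : F) : Set F) := by
    ext a
    rw [Finset.mem_coe, Polynomial.mem_nthRootsFinset hN, Set.mem_ofPred_eq]
  by_cases h : (r : ZMod N) = 0
  · simp only [hr, h, and_true, if_true, mul_one, hset]
    exact ⟨by rw [Set.ncard_coe_finset, hz.card_nthRootsFinset], Finset.finite_toSet _⟩
  · simp [hr, h]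

theorem stmt13 (K kbar : Type*) [Field K] [Fintype K] [Field kbar] [Algebra K kbar]
    [IsAlgClosure K kbar]
    (q N : ℕ) (hq : Fintype.card K = q) (hN : 0 < N) (hNq : N ∣ q - 1)
    (ζ : K) (hζ : orderOf ζ = N)
    (n : ℕ) (hn : 1 ≤ n) (r s : ℤ) :
    Set.ncard {p : kbar × kbar |
        p.1 ^ N + p.2 ^ N = 1 ∧
        p.1 ^ q ^ n = algebraMap K kbar ζ ^ r * p.1 ∧
        p.2 ^ q ^ n = algebraMap K kbar ζ ^ s * p.2} =
      N ^ 2 * Set.ncard {p : kbar × kbar |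
          p.1 ≠ 0 ∧ p.2 ≠ 0 ∧ p.1 ^ q ^ n = p.1 ∧ p.2 ^ q ^ n = p.2 ∧
          p.1 + p.2 = 1 ∧
          p.1 ^ ((q ^ n - 1) / N) = algebraMap K kbar ζ ^ r ∧
          p.2 ^ ((q ^ n - 1) / N) = algebraMap K kbar ζ ^ s} +
        N * (if (r : ZMod N) = 0 then 1 else 0) +
        N * (if (s : ZMod N) = 0 then 1 else 0) := by
  have : IsAlgClosed kbar := IsAlgClosure.isAlgClosed K
  set z := algebraMap K kbar ζ
  have hz : IsPrimitiveRoot z N :=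
    (hζ ▸ IsPrimitiveRoot.orderOf ζ).map_of_injective (algebraMap K kbar).injective
  have hzpow (t : ℤ) : (z ^ t) ^ N = 1 := by
    rw [← zpow_natCast, ← zpow_mul, mul_comm, zpow_mul, zpow_natCast, hz.pow_eq_one, one_zpow]
  have hq1 : 1 < q := hq ▸ Fintype.one_lt_card
  have hqn : 1 < q ^ n := Nat.one_lt_pow (by omega) hq1
  obtain ⟨m, hm⟩ : N ∣ q ^ n - 1 := hNq.trans (by simpa using Nat.sub_dvd_pow_sub_pow q 1 n)
  have hQ : q ^ n = N * m + 1 := by omega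
  have hm0 : 0 < m := Nat.pos_of_ne_zero (by rintro rfl; omega)
  rw [hm, Nat.mul_div_cancel_left m hN, hQ]
  set T : Set (kbar × kbar) := {p | p.1 ≠ 0 ∧ p.2 ≠ 0 ∧ p.1 ^ (N * m + 1) = p.1 ∧
    p.2 ^ (N * m + 1) = p.2 ∧ p.1 + p.2 = 1 ∧ p.1 ^ m = z ^ r ∧ p.2 ^ m = z ^ s} with hTdef
  have hTfin : T.Finite := by
    refine ((Finset.finite_toSet (Polynomial.nthRootsFinset m (z ^ r))).prod
      (Finset.finite_toSet (Polynomial.nthRootsFinset m (z ^ s)))).subset ?_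
    rintro p ⟨-, -, -, -, -, h1, h2⟩
    exact ⟨(Polynomial.mem_nthRootsFinset hm0 _).2 h1, (Polynomial.mem_nthRootsFinset hm0 _).2 h2⟩
  obtain ⟨hScard, hSfin⟩ := ncard_preimage_pow_prod hN hz T (fun p hp => ⟨hp.1, hp.2.1⟩) hTfin
  obtain ⟨hAcard, hAfin⟩ := ncard_setOf_pow_eq_one_and hN hz r
  obtain ⟨hBcard, hBfin⟩ := ncard_setOf_pow_eq_one_and hN hz s
  set S : Set (kbar × kbar) := {p | (p.1 ^ N, p.2 ^ N) ∈ T} with hS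
  set A : Set kbar := {a | a ^ N = 1 ∧ z ^ r = 1}
  set B : Set kbar := {a | a ^ N = 1 ∧ z ^ s = 1}
  have hroot {x c : kbar} (hx : x ^ N = 1) : x ^ (N * m + 1) = c * x ↔ c = 1 := by
    have hx0 : x ≠ 0 := by rintro rfl; simp [zero_pow hN.ne'] at hx
    rw [pow_eq_mul_self_iff_of_ne_zero hx0, hx, one_pow, eq_comm]
  have hdecomp : {p : kbar × kbar | p.1 ^ N + p.2 ^ N = 1 ∧ p.1 ^ (N * m + 1) = z ^ r * p.1 ∧
      p.2 ^ (N * m + 1) = z ^ s * p.2} = (S ∪ A ×ˢ {0}) ∪ {0} ×ˢ B := by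
    ext ⟨x, y⟩
    simp only [Set.mem_ofPred_eq, Set.mem_union, Set.mem_prod, Set.mem_singleton_iff, hS, hTdef, A,
      B]
    by_cases hx : x = 0
    · subst hx
      simp only [zero_pow hN.ne', zero_add]
      have hr0 : (0 : kbar) ^ (N * m + 1) = z ^ r * 0 := by simp
      constructor
      · rintro ⟨h, -, h2⟩
        exact Or.inr ⟨trivial, h, (hroot h).1 h2⟩
      · rintro ((h | h) | h)
        · exact absurd rfl h.1
        · exact absurd h.1.1 zero_ne_one
        · exact ⟨h.2.1, hr0, (hroot h.2.1).2 h.2.2⟩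
    by_cases hy : y = 0
    · subst hy
      simp only [zero_pow hN.ne', add_zero]
      have hs0 : (0 : kbar) ^ (N * m + 1) = z ^ s * 0 := by simp
      constructor
      · rintro ⟨h, h1, -⟩
        exact Or.inl (Or.inr ⟨⟨h, (hroot h).1 h1⟩, trivial⟩)
      · rintro ((h | h) | h)
        · exact absurd rfl h.2.1
        · exact ⟨h.1.1, (hroot h.1.1).2 h.1.2, hs0⟩
        · exact absurd h.1 hx
    rw [pow_eq_mul_self_iff_of_ne_zero hx, pow_eq_mul_self_iff_of_ne_zero hy]
    constructor
    · rintro ⟨h, h1, h2⟩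
      exact Or.inl (Or.inl ⟨pow_ne_zero N hx, pow_ne_zero N hy,
        pow_eq_self_of_pow_eq (hzpow r) h1, pow_eq_self_of_pow_eq (hzpow s) h2, h, h1, h2⟩)
    · rintro ((h | h) | h)
      · exact h.2.2.2.2
      · exact absurd h.2 hy
      · exact absurd h.1 hx
  have hdisj : Disjoint S (A ×ˢ {0}) := by
    rw [Set.disjoint_left]
    rintro ⟨x, y⟩ hp ⟨-, hy⟩
    exact hp.2.1 (by rw [Set.mem_singleton_iff.1 hy]; exact zero_pow hN.ne')
  have hdisj' : Disjoint (S ∪ A ×ˢ {0}) ({0} ×ˢ B) := by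
    rw [Set.disjoint_left]
    rintro ⟨x, y⟩ hp ⟨hx, -⟩
    have hx' : x ^ N = 0 := by rw [show x = 0 from hx]; exact zero_pow hN.ne'
    rcases hp with hp | hp
    · exact hp.1 hx'
    · exact zero_ne_one (hx'.symm.trans hp.1.1)
  have hA0 : (A ×ˢ ({0} : Set kbar)).Finite := hAfin.prod (Set.finite_singleton 0)
  have hB0 : (({0} : Set kbar) ×ˢ B).Finite := (Set.finite_singleton 0).prod hBfin
  rw [hdecomp, Set.ncard_union_eq hdisj' (hSfin.union hA0) hB0,
    Set.ncard_union_eq hdisj hSfin hA0, Set.ncard_prod, Set.ncard_prod, Set.ncard_singleton,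
    mul_one, one_mul, hScard, hAcard, hBcard]
end
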